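/- arXiv:1010.5205 — 2 statements merged into one kernel-verified Lean document; each statement's English description precedes it below -/
import Mathlib

section
/- Let D̄ be a closed disc in ℂ with centre 0 and let F : D̄ → ℂ be of Hölder class C^α(D̄) with 0 < α < 1. Assume there exist a nowhere-dense subset E ⊂ D̄, a nowhere-vanishing function A ∈ 𝒪(D̄), positive constants M, K > 0, and a number ν ≥ 1 such that for each ζ ∈ D̄ \ E there exist a function G_ζ ∈ 𝒪_ζ(D̄) satisfying |G_ζ(z)| ≤ M|z − ζ| for all z ∈ D̄, and a constant C_ζ with |C_ζ| = 1, so that C_ζ·(z − ζ)·(A(z)F(z) − A(ζ)F(ζ) + G_ζ(z)) ∈ W(K, ν) for all z ∈ D̄. Then Graph_{D̄}(F) is polynomially convex. -/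
open Complex Metric

noncomputable def pEval (x : ℂ × ℂ) (p : MvPolynomial (Fin 2) ℂ) : ℂ :=
  MvPolynomial.eval ![x.1, x.2] p

/-- The polynomially convex hull of a set in `ℂ²`. -/
noncomputable def polyHull (X : Set (ℂ × ℂ)) : Set (ℂ × ℂ) :=
  {x | ∀ p : MvPolynomial (Fin 2) ℂ, ‖pEval x p‖ ≤ ⨆ y ∈ X, ‖pEval y p‖}

def IsPolyConvex (X : Set (ℂ × ℂ)) : Prop := polyHull X = X

def graphOn (S : Set ℂ) (F : ℂ → ℂ) : Set (ℂ × ℂ) := {q | q.1 ∈ S ∧ q.2 = F q.1}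

def HolderOn (F : ℂ → ℂ) (α : ℝ) (S : Set ℂ) : Prop :=
  ∃ c : ℝ, 0 ≤ c ∧ ∀ z ∈ S, ∀ w ∈ S, ‖F z - F w‖ ≤ c * ‖z - w‖ ^ α

/-- Membership in `𝒪(S)`: holomorphic on some open neighbourhood of `S`. -/
def HoloNear (A : ℂ → ℂ) (S : Set ℂ) : Prop :=
  ∃ U : Set ℂ, IsOpen U ∧ S ⊆ U ∧ DifferentiableOn ℂ A U

/-- The wedge `W(K, ν) = {u + iv : u ≥ 0, |v| ≤ K u^{1/ν}}`. -/
noncomputable def wedge (K ν : ℝ) : Set ℂ :=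
  {w : ℂ | 0 ≤ w.re ∧ |w.im| ≤ K * w.re ^ (1 / ν)}

theorem pEval_continuous (p : MvPolynomial (Fin 2) ℂ) : Continuous fun x ↦ pEval x p := by
  unfold pEval
  refine (MvPolynomial.continuous_eval p).comp (continuous_pi fun i ↦ ?_)
  fin_cases i
  · exact continuous_fst
  · exact continuous_snd

theorem norm_pEval_le_of_mem_polyHull {X : Set (ℂ × ℂ)} {x : ℂ × ℂ} (hx : x ∈ polyHull X)
    (p : MvPolynomial (Fin 2) ℂ) {N : ℝ} (hN : 0 ≤ N) (h : ∀ y ∈ X, ‖pEval y p‖ ≤ N) :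
    ‖pEval x p‖ ≤ N :=
  (hx p).trans (Real.iSup_le (fun y ↦ Real.iSup_le (fun hy ↦ h y hy) hN) hN)

theorem subset_polyHull {X : Set (ℂ × ℂ)} (hX : IsCompact X) : X ⊆ polyHull X := by
  intro x hx p
  obtain ⟨B, hB⟩ := hX.exists_bound_of_continuousOn (pEval_continuous p).continuousOn
  have hB0 : 0 ≤ B := (norm_nonneg _).trans (hB x hx)
  have hbdd : BddAbove (Set.range fun y ↦ ⨆ _ : y ∈ X, ‖pEval y p‖) := by
    refine ⟨B, ?_⟩
    rintro _ ⟨y, rfl⟩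
    exact Real.iSup_le (fun hy ↦ hB y hy) hB0
  refine le_trans ?_ (le_ciSup hbdd x)
  simp [hx]

/-- `f` is a uniform limit of polynomials on `S`. -/
def PolyApproximable (S : Set (ℂ × ℂ)) (f : ℂ × ℂ → ℂ) : Prop :=
  ∀ ε > 0, ∃ p : MvPolynomial (Fin 2) ℂ, ∀ y ∈ S, ‖f y - pEval y p‖ ≤ ε

namespace PolyApproximable

variable {S : Set (ℂ × ℂ)} {f g : ℂ × ℂ → ℂ}

theorem of_pEval (p : MvPolynomial (Fin 2) ℂ) : PolyApproximable S fun y ↦ pEval y p :=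
  fun ε hε ↦ ⟨p, fun y _ ↦ by simpa using hε.le⟩

theorem const (c : ℂ) : PolyApproximable S fun _ ↦ c := by
  simpa [pEval] using of_pEval (S := S) (MvPolynomial.C c)

theorem fst : PolyApproximable S Prod.fst := by
  simpa [pEval] using of_pEval (S := S) (MvPolynomial.X 0)

theorem snd : PolyApproximable S Prod.snd := by
  simpa [pEval] using of_pEval (S := S) (MvPolynomial.X 1)

theorem add (hf : PolyApproximable S f) (hg : PolyApproximable S g) :
    PolyApproximable S fun y ↦ f y + g y := by
  intro ε hε
  obtain ⟨p, hp⟩ := hf (ε / 2) (by positivity)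
  obtain ⟨q, hq⟩ := hg (ε / 2) (by positivity)
  refine ⟨p + q, fun y hy ↦ ?_⟩
  have h : f y + g y - pEval y (p + q) = (f y - pEval y p) + (g y - pEval y q) := by
    simp only [pEval, map_add]; ring
  rw [h]
  linarith [norm_add_le (f y - pEval y p) (g y - pEval y q), hp y hy, hq y hy]

theorem exists_bound (hS : IsCompact S) (hf : PolyApproximable S f) :
    ∃ B, 0 ≤ B ∧ ∀ y ∈ S, ‖f y‖ ≤ B := by
  obtain ⟨p, hp⟩ := hf 1 one_pos
  obtain ⟨B, hB⟩ := hS.exists_bound_of_continuousOn (pEval_continuous p).continuousOn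
  refine ⟨max B 0 + 1, by positivity, fun y hy ↦ ?_⟩
  linarith [norm_sub_norm_le (f y) (pEval y p), hp y hy, hB y hy, le_max_left B 0]

theorem mul (hS : IsCompact S) (hf : PolyApproximable S f) (hg : PolyApproximable S g) :
    PolyApproximable S fun y ↦ f y * g y := by
  intro ε hε
  obtain ⟨B, hB0, hB⟩ := hg.exists_bound hS
  obtain ⟨p, hp⟩ := hf (ε / 2 / (B + 1)) (by positivity)
  obtain ⟨P, hP0, hP⟩ := (of_pEval p).exists_bound hS
  obtain ⟨q, hq⟩ := hg (ε / 2 / (P + 1)) (by positivity)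
  refine ⟨p * q, fun y hy ↦ ?_⟩
  have h : f y * g y - pEval y (p * q)
      = (f y - pEval y p) * g y + pEval y p * (g y - pEval y q) := by
    simp only [pEval, map_mul]; ring
  have h1 : ‖(f y - pEval y p) * g y‖ ≤ ε / 2 := by
    calc _ ≤ ε / 2 / (B + 1) * (B + 1) := by
          rw [norm_mul]; gcongr
          · exact hp y hy
          · linarith [hB y hy]
      _ = ε / 2 := by field_simp
  have h2 : ‖pEval y p * (g y - pEval y q)‖ ≤ ε / 2 := by
    calc _ ≤ (P + 1) * (ε / 2 / (P + 1)) := by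
          rw [norm_mul]; gcongr
          · linarith [hP y hy]
          · exact hq y hy
      _ = ε / 2 := by field_simp
  rw [h]
  linarith [norm_add_le ((f y - pEval y p) * g y) (pEval y p * (g y - pEval y q))]

theorem comp_fst {a : ℂ → ℂ} {T : Set ℂ} (hST : ∀ y ∈ S, y.1 ∈ T)
    (ha : ∀ ε > 0, ∃ p : Polynomial ℂ, ∀ z ∈ T, ‖a z - p.eval z‖ ≤ ε) :
    PolyApproximable S fun y ↦ a y.1 := by
  intro ε hε
  obtain ⟨p, hp⟩ := ha ε hε
  refine ⟨Polynomial.aeval (MvPolynomial.X 0) p, fun y hy ↦ ?_⟩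
  have h : pEval y (Polynomial.aeval (MvPolynomial.X 0) p) = p.eval y.1 := by
    rw [pEval, ← MvPolynomial.coe_aeval_eq_eval]
    have := Polynomial.aeval_algHom_apply (MvPolynomial.aeval ![y.1, y.2])
      (MvPolynomial.X 0 : MvPolynomial (Fin 2) ℂ) p
    rw [RingHom.coe_coe, ← this]
    simp
  rw [h]
  exact hp _ (hST y hy)

/-- A polynomially convex hull obeys the maximum principle for uniform limits of polynomials. -/
theorem norm_le {X : Set (ℂ × ℂ)} {x : ℂ × ℂ} (hf : PolyApproximable (insert x X) f)
    (hx : x ∈ polyHull X) {N : ℝ} (hN : 0 ≤ N) (h : ∀ y ∈ X, ‖f y‖ ≤ N) : ‖f x‖ ≤ N := by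
  refine le_of_forall_pos_le_add fun ε hε ↦ ?_
  obtain ⟨p, hp⟩ := hf (ε / 2) (by positivity)
  have h1 : ‖pEval x p‖ ≤ N + ε / 2 := by
    refine norm_pEval_le_of_mem_polyHull hx p (by positivity) fun y hy ↦ ?_
    linarith [norm_sub_norm_le (pEval y p) (f y), norm_sub_rev (pEval y p) (f y),
      hp y (Set.mem_insert_of_mem _ hy), h y hy]
  linarith [norm_sub_norm_le (f x) (pEval x p), hp x (Set.mem_insert _ _)]

theorem re_le {X : Set (ℂ × ℂ)} {x : ℂ × ℂ} (hX : IsCompact X)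
    (hf : PolyApproximable (insert x X) f) (hx : x ∈ polyHull X) {c : ℝ}
    (h : ∀ y ∈ X, (f y).re ≤ c) : (f x).re ≤ c := by
  obtain ⟨B, hB0, hB⟩ := hf.exists_bound (hX.insert x)
  refine le_of_forall_pos_le_add fun ε hε ↦ ?_
  set R : ℝ := B + |c| + B ^ 2 / ε with hR
  have hBε : 0 ≤ B ^ 2 / ε := by positivity
  have key : ‖f x + R‖ ≤ c + ε + R := by
    refine norm_le (f := fun y ↦ f y + R) (hf.add (const _)) hx
      (by linarith [neg_abs_le c]) fun y hy ↦ ?_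
    have hy' := hB y (Set.mem_insert_of_mem _ hy)
    have hre := (abs_le.1 ((abs_re_le_norm (f y)).trans hy')).1
    have him := (abs_im_le_norm (f y)).trans hy'
    refine abs_le_of_sq_le_sq' ?_ (by linarith [neg_abs_le c]) |>.2
    rw [Complex.sq_norm, Complex.normSq_apply]
    simp only [add_re, ofReal_re, add_im, ofReal_im, add_zero]
    have h1 : (f y).im * (f y).im ≤ B ^ 2 := by
      rw [← sq]; exact sq_le_sq.2 (by rwa [abs_of_nonneg hB0])
    have h2 : ((f y).re + R) * ((f y).re + R) ≤ (c + R) * (c + R) := by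
      have := h y hy
      have h3 : 0 ≤ (f y).re + R := by linarith [abs_nonneg c]
      exact mul_self_le_mul_self h3 (by linarith)
    have h4 : B ^ 2 ≤ ε * (c + R) := by
      calc B ^ 2 = ε * (B ^ 2 / ε) := by field_simp
        _ ≤ ε * (c + R) := by gcongr; linarith [neg_abs_le c]
    have h5 : 0 ≤ c + R := by linarith [neg_abs_le c]
    nlinarith [mul_nonneg hε.le h5]
  have := (re_le_norm (f x + R)).trans key
  simp only [add_re, ofReal_re] at this
  linarith

end PolyApproximable

theorem HoloNear.exists_polynomial_approx {a : ℂ → ℂ} {r : ℝ} (hr : 0 < r)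
    (ha : HoloNear a (closedBall 0 r)) {ε : ℝ} (hε : 0 < ε) :
    ∃ p : Polynomial ℂ, ∀ z ∈ closedBall (0 : ℂ) r, ‖a z - p.eval z‖ ≤ ε := by
  obtain ⟨U, hU, hSU, hd⟩ := ha
  obtain ⟨δ, hδ, hδU⟩ :=
    (isCompact_closedBall (0 : ℂ) r).exists_cthickening_subset_open hU hSU
  rw [cthickening_closedBall hδ.le hr.le] at hδU
  obtain ⟨R, hR⟩ : ∃ R : NNReal, (R : ℝ) = δ + r := CanLift.prf _ (by positivity)
  obtain ⟨R', hR'⟩ : ∃ R' : NNReal, (R' : ℝ) = r + δ / 2 := CanLift.prf _ (by positivity)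
  have hs := DifferentiableOn.hasFPowerSeriesOnBall (R := R) (hd.mono (hR ▸ hδU))
    (by rw [← NNReal.coe_pos]; linarith)
  have hu := hs.tendstoUniformlyOn (r' := R') (by
    rw [ENNReal.coe_lt_coe, ← NNReal.coe_lt_coe]; linarith)
  obtain ⟨n, hn⟩ := (Metric.tendstoUniformlyOn_iff.1 hu ε hε).exists
  refine ⟨∑ k ∈ Finset.range n, Polynomial.monomial k
    ((cauchyPowerSeries a 0 R).coeff k), fun z hz ↦ ?_⟩
  have := hn z (by
    simp only [mem_closedBall, dist_zero_right] at hz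
    simp only [mem_ball, dist_zero_right]
    linarith)
  rw [dist_eq_norm, zero_add, FormalMultilinearSeries.partialSum] at this
  refine le_trans (le_of_eq ?_) this.le
  congr 2
  rw [Polynomial.eval_finsetSum]
  refine Finset.sum_congr rfl fun k _ ↦ ?_
  rw [Polynomial.eval_monomial, FormalMultilinearSeries.apply_eq_pow_smul_coeff, smul_eq_mul,
    mul_comm]

theorem HoloNear.continuousOn {a : ℂ → ℂ} {S : Set ℂ} (ha : HoloNear a S) : ContinuousOn a S :=
  let ⟨_, _, hSU, hd⟩ := ha
  hd.continuousOn.mono hSU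

theorem HolderOn.continuousOn {F : ℂ → ℂ} {α : ℝ} {S : Set ℂ} (hα : 0 < α)
    (hF : HolderOn F α S) : ContinuousOn F S := by
  obtain ⟨c, -, h⟩ := hF
  intro w hw
  refine tendsto_iff_norm_sub_tendsto_zero.2
    (squeeze_zero' (Filter.Eventually.of_forall fun _ ↦ norm_nonneg _)
      (eventually_mem_nhdsWithin.mono fun z hz ↦ h z hz w hw) ?_)
  have h1 : ContinuousAt (fun z : ℂ ↦ c * ‖z - w‖ ^ α) w :=
    continuousAt_const.mul
      ((continuousAt_id.sub continuousAt_const).norm.rpow_const (Or.inr hα.le))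
  have h2 := h1.tendsto
  simp only [sub_self, norm_zero, Real.zero_rpow hα.ne', mul_zero] at h2
  exact h2.mono_left nhdsWithin_le_nhds

theorem isCompact_graphOn {S : Set ℂ} {F : ℂ → ℂ} (hS : IsCompact S) (hF : ContinuousOn F S) :
    IsCompact (graphOn S F) := by
  have h : graphOn S F = (fun z ↦ (z, F z)) '' S := by
    ext ⟨z, w⟩
    constructor
    · rintro ⟨h1, h2⟩
      exact ⟨z, h1, Prod.ext rfl h2.symm⟩
    · rintro ⟨y, hy, h⟩
      cases h
      exact ⟨hy, rfl⟩
  rw [h]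
  exact hS.image_of_continuousOn (continuousOn_id.prodMk hF)

/-- Points of the wedge with small real part are small. -/
theorem exists_pos_norm_lt_of_mem_wedge (K : ℝ) {ν ε : ℝ} (hν : 0 < ν) (hε : 0 < ε) :
    ∃ u > 0, ∀ w ∈ wedge K ν, w.re < u → ‖w‖ < ε := by
  have h1 : ContinuousAt (fun u : ℝ ↦ u + K * u ^ (1 / ν)) 0 :=
    continuousAt_id.add (continuousAt_const.mul
      (continuousAt_id.rpow_const (Or.inr (by positivity))))
  have h2 := h1.eventually_lt (continuousAt_const (y := ε))
    (by simpa [Real.zero_rpow (inv_pos.2 hν).ne'] using hε)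
  obtain ⟨u, hu, h⟩ := Metric.eventually_nhds_iff.1 h2
  refine ⟨u, hu, fun w hw hwu ↦ ?_⟩
  have h3 := h (y := w.re) (by rwa [Real.dist_eq, sub_zero, abs_of_nonneg hw.1])
  linarith [Complex.norm_le_abs_re_add_abs_im w, hw.2, abs_of_nonneg hw.1]

theorem exists_mem_diff_norm_sub_lt {r : ℝ} (hr : 0 < r) {E : Set ℂ} (hE : IsNowhereDense E)
    {z : ℂ} (hz : z ∈ closedBall (0 : ℂ) r) {δ : ℝ} (hδ : 0 < δ) :
    ∃ ζ ∈ closedBall (0 : ℂ) r \ E, ‖z - ζ‖ < δ := by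
  rw [← closure_ball _ hr.ne'] at hz
  have hne := mem_closure_iff.1 hz (ball z δ) isOpen_ball (mem_ball_self hδ)
  by_contra! hcon
  have hsub : ball z δ ∩ ball 0 r ⊆ interior (closure E) := by
    refine interior_maximal (fun ζ hζ ↦ subset_closure ?_) (isOpen_ball.inter isOpen_ball)
    by_contra hζE
    refine (hcon ζ ⟨ball_subset_closedBall hζ.2, hζE⟩).not_gt ?_
    rw [norm_sub_rev, ← dist_eq_norm]
    exact hζ.1
  rw [hE] at hsub
  exact hne.not_subset_empty hsub

/-- If `c * d * φ` lies in a wedge and `φ` is small whenever `d` is small, then `φ` is dominated,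
up to `ε`, by a multiple of the real part of `c * d * φ`. -/
theorem exists_norm_le_add_mul_re (K : ℝ) {ν ε δ B : ℝ} (hν : 0 < ν) (hε : 0 < ε) (hδ : 0 < δ)
    (hB : 0 ≤ B) :
    ∃ L ≥ 0, ∀ c d φ : ℂ, ‖c‖ = 1 → c * d * φ ∈ wedge K ν → (‖d‖ < δ → ‖φ‖ ≤ ε) → ‖φ‖ ≤ B →
      ‖φ‖ ≤ ε + L * (c * d * φ).re := by
  obtain ⟨u, hu, h⟩ := exists_pos_norm_lt_of_mem_wedge K hν (mul_pos hδ hε)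
  refine ⟨B / u, by positivity, fun c d φ hc hw hd hφ ↦ ?_⟩
  have hnn : 0 ≤ B / u * (c * d * φ).re := mul_nonneg (by positivity) hw.1
  by_cases hdδ : ‖d‖ < δ
  · linarith [hd hdδ]
  by_cases hre : (c * d * φ).re < u
  · have h1 := h _ hw hre
    rw [norm_mul, norm_mul, hc, one_mul] at h1
    have h2 : ‖φ‖ < ε := by
      by_contra! h3
      exact h1.not_ge (mul_le_mul (not_lt.1 hdδ) h3 hε.le (norm_nonneg _))
    linarith
  · have h1 : B = B / u * u := by field_simp
    have h2 : B / u * u ≤ B / u * (c * d * φ).re := by gcongr; exact not_lt.1 hre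
    linarith

/-- Theorem 1.1 (first part): the graph of `F` over the closed disc is
polynomially convex. -/
theorem holder_graph_polyConvex (r α M K ν : ℝ) (hr : 0 < r)
    (hα0 : 0 < α) (hα1 : α < 1)
    (F A : ℂ → ℂ) (E : Set ℂ)
    (hF : HolderOn F α (closedBall 0 r))
    (hE : E ⊆ closedBall 0 r) (hEnd : IsNowhereDense E)
    (hA : HoloNear A (closedBall 0 r))
    (hA0 : ∀ z ∈ closedBall (0 : ℂ) r, A z ≠ 0)
    (hM : 0 < M) (hK : 0 < K) (hν : 1 ≤ ν)
    (hyp : ∀ ζ ∈ closedBall (0 : ℂ) r \ E,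
      ∃ G : ℂ → ℂ, HoloNear G (closedBall 0 r) ∧ G ζ = 0 ∧
        (∀ z ∈ closedBall (0 : ℂ) r, ‖G z‖ ≤ M * ‖z - ζ‖) ∧
        ∃ C : ℂ, ‖C‖ = 1 ∧
          ∀ z ∈ closedBall (0 : ℂ) r,
            C * (z - ζ) * (A z * F z - A ζ * F ζ + G z) ∈ wedge K ν) :
    IsPolyConvex (graphOn (closedBall 0 r) F) := by
  set D := closedBall (0 : ℂ) r with hD
  have hDc : IsCompact D := isCompact_closedBall _ _
  have hFc := hF.continuousOn hα0
  have hX := isCompact_graphOn hDc hFc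
  refine Set.Subset.antisymm (fun x hx ↦ ?_) (subset_polyHull hX)
  have hx1 : x.1 ∈ D := by
    have h := (PolyApproximable.fst (S := insert x (graphOn D F))).norm_le hx hr.le
      fun y hy ↦ by simpa [hD] using hy.1
    simpa [hD] using h
  have hxD : ∀ y ∈ insert x (graphOn D F), y.1 ∈ D := by
    rintro y (rfl | hy)
    exacts [hx1, hy.1]
  have hXx := hX.insert x
  have hAF : ContinuousOn (fun z ↦ A z * F z) D := hA.continuousOn.mul hFc
  obtain ⟨B, hB⟩ := hDc.exists_bound_of_continuousOn hAF
  have hB0 : 0 ≤ B := (norm_nonneg _).trans (hB x.1 hx1)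
  have hunif := Metric.uniformContinuousOn_iff.1 (hDc.uniformContinuousOn_of_continuous hAF)
  set b : ℂ := A x.1 * x.2 - A x.1 * F x.1 with hb
  suffices h : ‖b‖ ≤ 0 by
    refine ⟨hx1, mul_left_cancel₀ (hA0 _ hx1) ?_⟩
    exact sub_eq_zero.1 (norm_le_zero_iff.1 h)
  refine le_of_forall_pos_le_add fun ε' hε' ↦ ?_
  obtain ⟨ε, hε, hεε'⟩ : ∃ ε > 0, ε' = 3 * ε := ⟨ε' / 3, by positivity, by ring⟩
  obtain ⟨δ₁, hδ₁, huc⟩ := hunif (ε / 2) (by positivity)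
  obtain ⟨δ, hδ, hδ₁', hδM⟩ : ∃ δ > 0, δ ≤ δ₁ ∧ M * δ ≤ ε / 2 :=
    ⟨min δ₁ (ε / 2 / M), by positivity, min_le_left _ _, by
      calc M * min δ₁ (ε / 2 / M) ≤ M * (ε / 2 / M) := by gcongr; exact min_le_right _ _
        _ = ε / 2 := by field_simp⟩
  have hclose : ∀ z ∈ D, ∀ ζ ∈ D, ∀ g : ℂ, ‖g‖ ≤ M * ‖z - ζ‖ → ‖z - ζ‖ < δ →
      ‖A z * F z - A ζ * F ζ + g‖ ≤ ε := by
    intro z hz ζ hζ g hg hzζ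
    have h1 := huc z hz ζ hζ (by rw [dist_eq_norm]; linarith)
    rw [dist_eq_norm] at h1
    have h2 : M * ‖z - ζ‖ ≤ M * δ := by gcongr
    linarith [norm_add_le (A z * F z - A ζ * F ζ) g]
  obtain ⟨L, hL0, hL⟩ := exists_norm_le_add_mul_re K (ν := ν) (B := 2 * B + M * (2 * r))
    (by linarith) hε hδ (by positivity)
  obtain ⟨η, hη, hηδ, hηL⟩ : ∃ η > 0, η ≤ δ ∧ L * η * (‖b‖ + ε) ≤ ε :=
    ⟨min δ (ε / ((L + 1) * (‖b‖ + ε))), by positivity, min_le_left _ _, by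
      calc L * min δ (ε / ((L + 1) * (‖b‖ + ε))) * (‖b‖ + ε)
          ≤ (L + 1) * (ε / ((L + 1) * (‖b‖ + ε))) * (‖b‖ + ε) := by
            gcongr
            · linarith
            · exact min_le_right _ _
        _ = ε := by field_simp⟩
  obtain ⟨ζ, hζ, hxζ⟩ := exists_mem_diff_norm_sub_lt hr hEnd hx1 hη
  obtain ⟨G, hG, -, hGM, C, hC, hW⟩ := hyp ζ hζ
  set φ : ℂ × ℂ → ℂ := fun y ↦ A y.1 * y.2 + -(A ζ * F ζ) + G y.1 with hφ
  have hφX : ∀ y ∈ graphOn D F, ‖φ y‖ ≤ ε + L * (C * (y.1 - ζ) * φ y).re := by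
    rintro ⟨z, w⟩ ⟨hz, hw⟩
    obtain rfl : w = F z := hw
    simp only [hφ, ← sub_eq_add_neg]
    refine hL C (z - ζ) _ hC (hW z hz) (hclose z hz ζ hζ.1 _ (hGM z hz)) ?_
    have h1 : ‖z - ζ‖ ≤ 2 * r := by
      have h3 : ‖z‖ ≤ r := by simpa [hD] using hz
      have h4 : ‖ζ‖ ≤ r := by simpa [hD] using hζ.1
      linarith [norm_sub_le z ζ]
    have h2 : M * ‖z - ζ‖ ≤ M * (2 * r) := by gcongr
    linarith [norm_add_le (A z * F z - A ζ * F ζ) (G z), norm_sub_le (A z * F z) (A ζ * F ζ),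
      hB z hz, hB ζ hζ.1, hGM z hz]
  have hφa : PolyApproximable (insert x (graphOn D F)) φ :=
    (((PolyApproximable.comp_fst hxD fun _ h ↦ hA.exists_polynomial_approx hr h).mul hXx .snd).add
      (.const _)).add (.comp_fst hxD fun _ h ↦ hG.exists_polynomial_approx hr h)
  obtain ⟨τ, hτ, hτφ⟩ : ∃ τ : ℂ, ‖τ‖ = 1 ∧ ‖φ x‖ = τ * φ x := Complex.exists_norm_eq_mul_self _
  have hmain := PolyApproximable.re_le (c := ε)
    (f := fun y ↦ (τ + -(L * C) * (y.1 + -ζ)) * φ y) hX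
    (((PolyApproximable.const τ).add
      ((PolyApproximable.const _).mul hXx (PolyApproximable.fst.add (.const _)))).mul hXx hφa)
    hx fun y hy ↦ by
      have h1 : (τ + -(L * C) * (y.1 + -ζ)) * φ y = τ * φ y - L * (C * (y.1 - ζ) * φ y) := by ring
      rw [h1, sub_re, re_ofReal_mul]
      have h2 := re_le_norm (τ * φ y)
      rw [norm_mul, hτ, one_mul] at h2
      linarith [hφX y hy]
  have h1 : (τ + -(L * C) * (x.1 + -ζ)) * φ x = τ * φ x - L * (C * (x.1 - ζ) * φ x) := by ring
  rw [h1, sub_re, re_ofReal_mul, ← hτφ, ofReal_re] at hmain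
  have h2 : L * (C * (x.1 - ζ) * φ x).re ≤ L * (η * ‖φ x‖) := by
    gcongr
    refine (re_le_norm _).trans ?_
    rw [norm_mul, norm_mul, hC, one_mul]
    gcongr
  have h3 := hclose x.1 hx1 ζ hζ.1 _ (hGM _ hx1) (by linarith)
  have h4 : φ x = b + (A x.1 * F x.1 - A ζ * F ζ + G x.1) := by simp only [hφ, hb]; ring
  have h5 : ‖φ x‖ ≤ ‖b‖ + ε := by
    rw [h4]; linarith [norm_add_le b (A x.1 * F x.1 - A ζ * F ζ + G x.1)]
  have h6 : ‖b‖ ≤ ‖φ x‖ + ε := by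
    have h7 : b = φ x - (A x.1 * F x.1 - A ζ * F ζ + G x.1) := by rw [h4]; ring
    rw [h7]; linarith [norm_sub_le (φ x) (A x.1 * F x.1 - A ζ * F ζ + G x.1)]
  have h8 : L * (η * ‖φ x‖) ≤ L * η * (‖b‖ + ε) := by
    rw [mul_assoc]; gcongr
  linarith
end

section
/- Let D̄ be a closed disc in ℂ with centre 0 and let F : D̄ → ℂ be of Hölder class C^α(D̄) with 0 < α < 1, satisfying the hypothesis: there exist a nowhere-dense subset E ⊂ D̄, a nowhere-vanishing function A ∈ 𝒪(D̄), positive constants M, K > 0, and ν ≥ 1 such that for each ζ ∈ D̄ \ E there exist G_ζ ∈ 𝒪_ζ(D̄) with |G_ζ(z)| ≤ M|z − ζ| on D̄ and C_ζ of modulus 1 with C_ζ·(z − ζ)·(A(z)F(z) − A(ζ)F(ζ) + G_ζ(z)) ∈ W(K, ν) for all z ∈ D̄. If, additionally, F ∈ C¹(D̄) (in the real sense) and the set L_F := {z ∈ D̄ : ∂_z̄F(z) = 0} is nowhere dense in D̄ and finitely connected, then [z, F]_{D̄} = C(D̄): every continuous complex-valued function on D̄ is a uniform limit on D̄ of polynomials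 in z and F(z). -/
open Complex Metric

/-- `S ⊂ ℂ` is finitely connected if its complement in the one-point
compactification of `ℂ` has finitely many connected components. -/
def FinitelyConnected (S : Set ℂ) : Prop :=
  Finite (ConnectedComponents ↥(((fun z : ℂ => (z : OnePoint ℂ)) '' S)ᶜ))

/-- The Wirtinger derivative `∂F/∂z̄ = (1/2)(∂F/∂x + i ∂F/∂y)` expressed via a
real Fréchet derivative `F'`. -/
noncomputable def dbar (F' : ℂ → ℂ →L[ℝ] ℂ) (z : ℂ) : ℂ :=
  (1 / 2 : ℂ) * (F' z 1 + Complex.I * F' z Complex.I)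

section

open MeasureTheory Filter Topology Set
open scoped ENNReal

/-- A function holomorphic on an open disc is uniformly approximable by polynomials on smaller
closed discs. -/
theorem exists_polynomial_approx_of_differentiableOn_ball {u : ℂ → ℂ} {c : ℂ} {R ρ : ℝ}
    (hu : DifferentiableOn ℂ u (ball c R)) (hρ : ρ < R) {ε : ℝ} (hε : 0 < ε) :
    ∃ p : Polynomial ℂ, ∀ w ∈ closedBall c ρ, ‖u w - p.eval w‖ < ε := by
  rcases lt_or_ge ρ 0 with h0 | h0
  · exact ⟨0, fun w hw => by simp [closedBall_eq_empty.2 h0] at hw⟩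
  obtain ⟨R₁, h1, h2⟩ := exists_between hρ
  obtain ⟨R₂, h3, h4⟩ := exists_between h1
  have hR₁ : 0 < R₁ := h0.trans_lt h1
  lift R₁ to NNReal using hR₁.le
  have hR₂ : 0 < R₂ := h0.trans_lt h3
  lift R₂ to NNReal using hR₂.le
  have hs := (hu.mono (closedBall_subset_ball h2)).hasFPowerSeriesOnBall (by exact_mod_cast hR₁)
  have ht := hs.tendstoUniformlyOn (r' := R₂) (by exact_mod_cast h4)
  rw [Metric.tendstoUniformlyOn_iff] at ht
  obtain ⟨n, hn⟩ := (ht ε hε).exists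
  refine ⟨∑ k ∈ Finset.range n, Polynomial.C ((cauchyPowerSeries u c R₁).coeff k) *
    (Polynomial.X - Polynomial.C c) ^ k, fun w hw => ?_⟩
  have hw' : w - c ∈ ball (0 : ℂ) R₂ := by
    rw [mem_ball_zero_iff, ← dist_eq_norm]
    exact (mem_closedBall.1 hw).trans_lt h3
  have := hn (w - c) hw'
  rw [dist_eq_norm, add_sub_cancel] at this
  rw [Polynomial.eval_finsetSum]
  refine lt_of_eq_of_lt ?_ this
  congr 2
  refine Finset.sum_congr rfl fun k _ => ?_
  simp [mul_comm]

/-- `PolyApprox F S φ`: on `S`, `φ` is a uniform limit of polynomials in `z` and `F z`. -/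
def PolyApprox (F : ℂ → ℂ) (S : Set ℂ) (φ : ℂ → ℂ) : Prop :=
  ∀ ε > 0, ∃ P : MvPolynomial (Fin 2) ℂ, ∀ z ∈ S, ‖φ z - MvPolynomial.eval ![z, F z] P‖ < ε

namespace PolyApprox

variable {F : ℂ → ℂ} {S : Set ℂ} {φ ψ : ℂ → ℂ}

theorem eval (P : MvPolynomial (Fin 2) ℂ) :
    PolyApprox F S fun z => MvPolynomial.eval ![z, F z] P :=
  fun ε hε => ⟨P, fun z _ => by simpa using hε⟩

theorem const (c : ℂ) : PolyApprox F S fun _ => c := by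
  simpa using eval (F := F) (S := S) (MvPolynomial.C c)

theorem id : PolyApprox F S fun z => z := by
  simpa using eval (F := F) (S := S) (MvPolynomial.X 0)

theorem self : PolyApprox F S F := by
  simpa using eval (F := F) (S := S) (MvPolynomial.X 1)

theorem of_forall_approx (h : ∀ ε > 0, ∃ ψ, PolyApprox F S ψ ∧ ∀ z ∈ S, ‖φ z - ψ z‖ < ε) :
    PolyApprox F S φ := by
  intro ε hε
  obtain ⟨ψ, hψ, h1⟩ := h (ε / 2) (half_pos hε)
  obtain ⟨P, hP⟩ := hψ (ε / 2) (half_pos hε)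
  refine ⟨P, fun z hz => ?_⟩
  calc _ = ‖(φ z - ψ z) + (ψ z - MvPolynomial.eval ![z, F z] P)‖ := by ring_nf
    _ ≤ _ := norm_add_le _ _
    _ < ε := by linarith [h1 z hz, hP z hz]

theorem add (h1 : PolyApprox F S φ) (h2 : PolyApprox F S ψ) :
    PolyApprox F S fun z => φ z + ψ z := by
  intro ε hε
  obtain ⟨P, hP⟩ := h1 (ε / 2) (half_pos hε)
  obtain ⟨Q, hQ⟩ := h2 (ε / 2) (half_pos hε)
  refine ⟨P + Q, fun z hz => ?_⟩
  calc _ = ‖(φ z - MvPolynomial.eval ![z, F z] P) + (ψ z - MvPolynomial.eval ![z, F z] Q)‖ := by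
        rw [map_add]; ring_nf
    _ ≤ _ := norm_add_le _ _
    _ < ε := by linarith [hP z hz, hQ z hz]

theorem continuousOn (hF : ContinuousOn F S) (h : PolyApprox F S φ) : ContinuousOn φ S := by
  refine continuousOn_of_uniform_approx_of_continuousOn fun u hu => ?_
  obtain ⟨ε, hε, hu⟩ := Metric.mem_uniformity_dist.1 hu
  obtain ⟨P, hP⟩ := h ε hε
  refine ⟨fun z => MvPolynomial.eval ![z, F z] P, ?_, fun z hz => hu ?_⟩
  · have : Continuous fun v : Fin 2 → ℂ => MvPolynomial.eval v P := MvPolynomial.continuous_eval P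
    refine this.comp_continuousOn (continuousOn_pi.2 fun i => ?_)
    fin_cases i
    · exact continuousOn_id
    · exact hF
  · rw [dist_eq_norm]; exact hP z hz

theorem exists_bound (hS : IsCompact S) (hF : ContinuousOn F S) (h : PolyApprox F S φ) :
    ∃ B > 0, ∀ z ∈ S, ‖φ z‖ ≤ B := by
  obtain ⟨B, hB⟩ := hS.exists_bound_of_continuousOn (h.continuousOn hF)
  exact ⟨max B 1, by positivity, fun z hz => (hB z hz).trans (le_max_left _ _)⟩

theorem mul (hS : IsCompact S) (hF : ContinuousOn F S)
    (h1 : PolyApprox F S φ) (h2 : PolyApprox F S ψ) :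
    PolyApprox F S fun z => φ z * ψ z := by
  obtain ⟨B, hB0, hB⟩ := h2.exists_bound hS hF
  refine of_forall_approx fun ε hε => ?_
  obtain ⟨P, hP⟩ := h1 (ε / (2 * B)) (by positivity)
  obtain ⟨C, hC0, hC⟩ := (eval (F := F) P).exists_bound hS hF
  obtain ⟨Q, hQ⟩ := h2 (ε / (2 * C)) (by positivity)
  refine ⟨_, eval (P * Q), fun z hz => ?_⟩
  calc _ = ‖(φ z - MvPolynomial.eval ![z, F z] P) * ψ z +
        MvPolynomial.eval ![z, F z] P * (ψ z - MvPolynomial.eval ![z, F z] Q)‖ := by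
        rw [map_mul]; ring_nf
    _ ≤ _ := norm_add_le _ _
    _ = ‖φ z - MvPolynomial.eval ![z, F z] P‖ * ‖ψ z‖ +
        ‖MvPolynomial.eval ![z, F z] P‖ * ‖ψ z - MvPolynomial.eval ![z, F z] Q‖ := by
        rw [norm_mul, norm_mul]
    _ ≤ ‖φ z - MvPolynomial.eval ![z, F z] P‖ * B +
        C * ‖ψ z - MvPolynomial.eval ![z, F z] Q‖ := by
        gcongr
        · exact hB z hz
        · exact hC z hz
    _ < ε / (2 * B) * B + C * (ε / (2 * C)) := by
        gcongr
        · exact hP z hz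
        · exact hQ z hz
    _ = ε := by field_simp; norm_num

theorem const_mul (c : ℂ) (h : PolyApprox F S φ) : PolyApprox F S fun z => c * φ z := by
  intro ε hε
  obtain ⟨P, hP⟩ := h (ε / (‖c‖ + 1)) (by positivity)
  refine ⟨MvPolynomial.C c * P, fun z hz => ?_⟩
  rw [map_mul, MvPolynomial.eval_C, ← mul_sub, norm_mul]
  calc _ ≤ (‖c‖ + 1) * ‖φ z - MvPolynomial.eval ![z, F z] P‖ := by gcongr; linarith
    _ < (‖c‖ + 1) * (ε / (‖c‖ + 1)) := by gcongr; exact hP z hz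
    _ = ε := by field_simp

theorem sub (h1 : PolyApprox F S φ) (h2 : PolyApprox F S ψ) :
    PolyApprox F S fun z => φ z - ψ z := by
  simpa [sub_eq_add_neg] using h1.add (h2.const_mul (-1))

theorem sum {ι : Type*} (s : Finset ι) (φ : ι → ℂ → ℂ) (h : ∀ i ∈ s, PolyApprox F S (φ i)) :
    PolyApprox F S fun z => ∑ i ∈ s, φ i z := by
  classical
  induction s using Finset.induction_on with
  | empty => simpa using const (F := F) (S := S) 0
  | insert a s ha ih =>
    simp only [Finset.sum_insert ha]
    exact (h a (Finset.mem_insert_self a s)).add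
      (ih fun i hi => h i (Finset.mem_insert_of_mem hi))

theorem polynomial_eval (hS : IsCompact S) (hF : ContinuousOn F S) (h : PolyApprox F S φ)
    (p : Polynomial ℂ) : PolyApprox F S fun z => p.eval (φ z) := by
  induction p using Polynomial.induction_on with
  | C a => simpa using const a
  | add p q hp hq => simpa using hp.add hq
  | monomial n a ih =>
    have := mul hS hF ih h
    simpa [pow_succ, mul_assoc] using this

/-- Holomorphic functional calculus for functions with values in a disc. -/
theorem comp_of_mapsTo_ball (hS : IsCompact S) (hF : ContinuousOn F S) (h : PolyApprox F S φ)
    {u : ℂ → ℂ} {c : ℂ} {R : ℝ} (hu : DifferentiableOn ℂ u (ball c R))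
    (hφ : ∀ z ∈ S, φ z ∈ ball c R) : PolyApprox F S fun z => u (φ z) := by
  have hcomp : IsCompact (φ '' S) := hS.image_of_continuousOn (h.continuousOn hF)
  obtain ⟨ρ, hρ, hsub⟩ : ∃ ρ < R, φ '' S ⊆ closedBall c ρ := by
    rcases S.eq_empty_or_nonempty with rfl | hne
    · exact ⟨R - 1, by linarith, by simp⟩
    obtain ⟨w, hw, hmax⟩ := hcomp.exists_isMaxOn (hne.image φ)
      (continuous_id.dist (continuous_const (y := c))).continuousOn
    refine ⟨dist w c, ?_, fun x hx => hmax hx⟩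
    obtain ⟨z, hz, rfl⟩ := hw
    exact hφ z hz
  refine of_forall_approx fun ε hε => ?_
  obtain ⟨p, hp⟩ := exists_polynomial_approx_of_differentiableOn_ball hu hρ hε
  exact ⟨_, h.polynomial_eval hS hF p, fun z hz => hp _ (hsub (mem_image_of_mem φ hz))⟩

theorem of_holoNear {r : ℝ} (hr : 0 < r) (hF : ContinuousOn F (closedBall 0 r)) {A : ℂ → ℂ}
    (hA : HoloNear A (closedBall 0 r)) : PolyApprox F (closedBall 0 r) A := by
  obtain ⟨U, hU, hsub, hd⟩ := hA
  obtain ⟨δ, hδ, hth⟩ := (isCompact_closedBall (0 : ℂ) r).exists_thickening_subset_open hU hsub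
  rw [thickening_closedBall hδ hr.le] at hth
  exact id.comp_of_mapsTo_ball (isCompact_closedBall 0 r) hF (hd.mono hth)
    fun z hz => closedBall_subset_ball (by linarith) hz

theorem inv_add (hS : IsCompact S) (hF : ContinuousOn F S) (h : PolyApprox F S φ)
    (hre : ∀ z ∈ S, 0 ≤ (φ z).re) {ε : ℝ} (hε : 0 < ε) :
    PolyApprox F S fun z => (φ z + ε)⁻¹ := by
  obtain ⟨B, hB0, hB⟩ := (h.add (const ε)).exists_bound hS hF
  have hu : DifferentiableOn ℂ (fun w : ℂ => w⁻¹) (ball ((B ^ 2 / ε : ℝ) : ℂ) (B ^ 2 / ε)) := by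
    refine differentiableOn_inv.mono fun w hw h0 => ?_
    rw [mem_ball, mem_singleton_iff.1 h0, dist_eq_norm, zero_sub, norm_neg, norm_real,
      Real.norm_of_nonneg (by positivity)] at hw
    exact lt_irrefl _ hw
  refine (h.add (const ε)).comp_of_mapsTo_ball hS hF hu fun z hz => ?_
  rw [mem_ball, dist_eq_norm]
  refine lt_of_pow_lt_pow_left₀ 2 (by positivity) ?_
  have h1 := hB z hz
  have h2 := hre z hz
  set w := φ z + ε with hw
  have h3 : ε ≤ w.re := by simp [hw, h2]
  have h4 : ‖w‖ ^ 2 ≤ B ^ 2 := by gcongr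
  rw [← normSq_eq_norm_sq, normSq_apply] at h4 ⊢
  have h5 : B ^ 2 ≤ B ^ 2 / ε * w.re := by
    rw [div_mul_eq_mul_div, le_div_iff₀ hε]; gcongr
  simp only [sub_re, ofReal_re, sub_im, ofReal_im, sub_zero]
  have : 0 < B ^ 2 := by positivity
  nlinarith

end PolyApprox

open scoped CompactlySupported in
/-- A functional on `C(X, ℝ)` that is nonnegative on nonnegative functions is integration against a
finite measure. -/
theorem exists_measure_of_nonneg_functional {X : Type*} [TopologicalSpace X] [CompactSpace X]
    [T2Space X] [MeasurableSpace X] [BorelSpace X] (f : C(X, ℝ) →L[ℝ] ℝ)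
    (hf : ∀ g : C(X, ℝ), (∀ x, 0 ≤ g x) → 0 ≤ f g) :
    ∃ ν : Measure X, IsFiniteMeasure ν ∧ ∀ g : C(X, ℝ), ∫ x, g x ∂ν = f g := by
  let L : C_c(X, ℝ) →ₗ[ℝ] ℝ :=
    { toFun := fun g => f g.toContinuousMap
      map_add' := fun g h => by rw [← map_add]; rfl
      map_smul' := fun c g => by rw [RingHom.id_apply, ← map_smul]; rfl }
  let Λ : C_c(X, ℝ) →ₚ[ℝ] ℝ := PositiveLinearMap.mk₀ L fun g hg => hf _ fun x => hg x
  refine ⟨RealRMK.rieszMeasure Λ, inferInstance, fun g => ?_⟩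
  exact RealRMK.integral_rieszMeasure Λ
    ⟨g, HasCompactSupport.of_compactSpace g⟩

theorem exists_measure_lt_integral_norm_sq {F φ : ℂ → ℂ} {S : Set ℂ} (hS : IsCompact S)
    (hF : ContinuousOn F S) (hφ : ContinuousOn φ S) (h : ¬ PolyApprox F S φ) :
    ∃ ν : Measure ℂ, IsFiniteMeasure ν ∧ ν Sᶜ = 0 ∧ ∃ c > 0, ∀ P : MvPolynomial (Fin 2) ℂ,
      c ≤ ∫ z, ‖φ z - MvPolynomial.eval ![z, F z] P‖ ^ 2 ∂ν := by
  simp only [PolyApprox, not_forall, not_exists, not_lt] at h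
  obtain ⟨ε, hε, h⟩ := h
  have : CompactSpace S := isCompact_iff_compactSpace.1 hS
  let D (P : MvPolynomial (Fin 2) ℂ) (x : S) : ℂ := φ x - MvPolynomial.eval ![(x : ℂ), F x] P
  have hD : ∀ P, Continuous (D P) := fun P =>
    (hφ.sub ((PolyApprox.eval P).continuousOn hF)).domRestrict
  let s : Set C(S, ℝ) := {u | MapsTo u univ (Iio (ε ^ 2))}
  let t : Set C(S, ℝ) := {u | ∃ P, ∀ x, ‖D P x‖ ^ 2 ≤ u x}
  have hs1 : Convex ℝ s := by
    intro u hu v hv a b ha hb hab x _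
    exact (convex_Iio (ε ^ 2)) (hu (mem_univ x)) (hv (mem_univ x)) ha hb hab
  have hs2 : IsOpen s := ContinuousMap.isOpen_setOfPred_mapsTo isCompact_univ isOpen_Iio
  have ht : Convex ℝ t := by
    rintro u ⟨P, hP⟩ v ⟨Q, hQ⟩ a b ha hb hab
    refine ⟨MvPolynomial.C (a : ℂ) * P + MvPolynomial.C (b : ℂ) * Q, fun x => ?_⟩
    have e : D (MvPolynomial.C (a : ℂ) * P + MvPolynomial.C (b : ℂ) * Q) x
        = a • D P x + b • D Q x := by
      have : (a : ℂ) + b = 1 := by exact_mod_cast hab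
      simp only [D, map_add, map_mul, MvPolynomial.eval_C, real_smul]
      linear_combination (-φ x) * this
    rw [e]
    have hc : ConvexOn ℝ univ fun w : ℂ => ‖w‖ ^ 2 :=
      (convexOn_norm convex_univ).pow (fun _ _ => norm_nonneg _) 2
    refine (hc.2 (mem_univ _) (mem_univ _) ha hb hab).trans ?_
    simp only [ContinuousMap.add_apply, ContinuousMap.smul_apply, smul_eq_mul]
    gcongr
    · exact hP x
    · exact hQ x
  have hdisj : Disjoint s t := by
    rw [Set.disjoint_left]
    rintro u hu ⟨P, hP⟩
    obtain ⟨z, hz, hzP⟩ := h P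
    have h1 := hP ⟨z, hz⟩
    have h2 : u ⟨z, hz⟩ < ε ^ 2 := hu (mem_univ _)
    have h3 : ε ^ 2 ≤ ‖D P ⟨z, hz⟩‖ ^ 2 := by gcongr
    linarith
  obtain ⟨f, c, hfs, hft⟩ := geometric_hahn_banach_open hs1 hs2 ht hdisj
  have hc : 0 < c := by
    have := hfs 0 fun x _ => pow_pos hε 2
    rwa [map_zero] at this
  let N (P : MvPolynomial (Fin 2) ℂ) : C(S, ℝ) := ⟨fun x => ‖D P x‖ ^ 2, (hD P).norm.pow 2⟩
  obtain ⟨ν, hν, hint⟩ := exists_measure_of_nonneg_functional f fun g hg => by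
    by_contra hneg
    push Not at hneg
    obtain ⟨n, hn⟩ := exists_nat_gt ((f (N 0) - c) / (-f g))
    have h1 := hft (N 0 + (n : ℝ) • g) ⟨0, fun x => by
      have := hg x
      simp only [N, ContinuousMap.add_apply, ContinuousMap.coe_mk, ContinuousMap.smul_apply,
        smul_eq_mul]
      nlinarith [(n.cast_nonneg : (0 : ℝ) ≤ n)]⟩
    rw [map_add, map_smul, smul_eq_mul] at h1
    rw [div_lt_iff₀ (by linarith)] at hn
    linarith
  have hemb : MeasurableEmbedding ((↑) : S → ℂ) :=
    MeasurableEmbedding.subtype_coe hS.isClosed.measurableSet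
  refine ⟨ν.map (↑), inferInstance, ?_, c, hc, fun P => ?_⟩
  · rw [hemb.map_apply]; simp
  · rw [hemb.integral_map]
    exact (hft (N P) ⟨P, fun x => le_rfl⟩).trans_eq (hint (N P)).symm

theorem exists_annihilating_density {F φ : ℂ → ℂ} {S : Set ℂ} (hS : IsCompact S)
    (hF : ContinuousOn F S) (hφ : ContinuousOn φ S) (h : ¬ PolyApprox F S φ) :
    ∃ (ν : Measure ℂ) (q : ℂ → ℂ), IsFiniteMeasure ν ∧ ν Sᶜ = 0 ∧ Integrable q ν ∧
      (∀ ψ, PolyApprox F S ψ → ∫ z, ψ z * q z ∂ν = 0) ∧ ∫ z, φ z * q z ∂ν ≠ 0 := by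
  obtain ⟨ν, hν, hνS, c, hc, hcP⟩ := exists_measure_lt_integral_norm_sq hS hF hφ h
  have hres : ν.restrict S = ν := Measure.restrict_eq_self_of_ae_mem (by
    rw [ae_iff]; exact hνS)
  have hmem : ∀ ψ : ℂ → ℂ, ContinuousOn ψ S → MemLp ψ 2 ν := by
    intro ψ hψ
    obtain ⟨B, hB⟩ := hS.exists_bound_of_continuousOn hψ
    rw [← hres]
    exact MemLp.of_bound (hψ.aestronglyMeasurable hS.isClosed.measurableSet) B
      ((ae_restrict_iff' hS.isClosed.measurableSet).2 (Eventually.of_forall hB))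
  have hP : ∀ P : MvPolynomial (Fin 2) ℂ, MemLp (fun z => MvPolynomial.eval ![z, F z] P) 2 ν :=
      fun P =>
    hmem _ ((PolyApprox.eval P).continuousOn hF)
  let T : MvPolynomial (Fin 2) ℂ →ₗ[ℂ] Lp ℂ 2 ν :=
    { toFun := fun P => (hP P).toLp _
      map_add' := fun P Q => by
        rw [← MemLp.toLp_add]; congr 1; ext z; simp
      map_smul' := fun a P => by
        rw [RingHom.id_apply, ← MemLp.toLp_const_smul]
        congr 1
        ext z
        simp [MvPolynomial.smul_eval] }
  let K := (LinearMap.range T).topologicalClosure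
  have : CompleteSpace K := (Submodule.isClosed_topologicalClosure _).completeSpace_coe
  let Φ : Lp ℂ 2 ν := (hmem φ hφ).toLp φ
  have hΦ : Φ ∉ K := by
    intro hmemK
    rw [← SetLike.mem_coe, Submodule.topologicalClosure_coe, Metric.mem_closure_iff] at hmemK
    obtain ⟨_, ⟨P, rfl⟩, hb⟩ := hmemK (Real.sqrt c) (Real.sqrt_pos.2 hc)
    have h1 : ‖Φ - T P‖ ^ 2 < c := by
      rw [← dist_eq_norm]
      exact (Real.lt_sqrt dist_nonneg).1 hb
    have h2 : ‖Φ - T P‖ ^ 2 = ∫ z, ‖φ z - MvPolynomial.eval ![z, F z] P‖ ^ 2 ∂ν := by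
      have h3 : inner ℂ (Φ - T P) (Φ - T P) = ((‖Φ - T P‖ ^ 2 : ℝ) : ℂ) := by
        rw [inner_self_eq_norm_sq_to_K]; norm_cast
      have h4 : Φ - T P = ((hmem φ hφ).sub (hP P)).toLp _ :=
        (MemLp.toLp_sub (hmem φ hφ) (hP P)).symm
      rw [L2.inner_def] at h3
      have h5 : ∫ z, inner ℂ ((Φ - T P : Lp ℂ 2 ν) z) ((Φ - T P : Lp ℂ 2 ν) z) ∂ν =
          ((∫ z, ‖φ z - MvPolynomial.eval ![z, F z] P‖ ^ 2 ∂ν : ℝ) : ℂ) := by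
        rw [← integral_complex_ofReal]
        refine integral_congr_ae ?_
        rw [h4]
        filter_upwards [((hmem φ hφ).sub (hP P)).coeFn_toLp] with z hz
        rw [hz, inner_self_eq_norm_sq_to_K]
        norm_cast
      rw [h5] at h3
      exact_mod_cast h3.symm
    linarith [hcP P]
  let y : Lp ℂ 2 ν := Φ - K.starProjection Φ
  have hy : y ∈ Kᗮ := Submodule.sub_starProjection_mem_orthogonal Φ
  have hy0 : y ≠ 0 := fun h0 => hΦ (by
    rw [sub_eq_zero.1 h0]; exact Submodule.starProjection_apply_mem K Φ)
  have hyΦ : inner ℂ y Φ ≠ 0 := by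
    have : Φ = y + K.starProjection Φ := by simp [y]
    rw [this, inner_add_right, Submodule.inner_left_of_mem_orthogonal
      (Submodule.starProjection_apply_mem K Φ) hy, add_zero]
    exact inner_self_ne_zero.2 hy0
  have hyi : Integrable y ν := (Lp.memLp y).integrable (by norm_num)
  have hq : Integrable (fun z => (starRingEnd ℂ) (y z)) ν :=
    (LinearIsometryEquiv.integrable_comp_iff conjLIE (φ := y)).2 hyi
  have hinner : ∀ ψ (hψ : MemLp ψ 2 ν), inner ℂ y (hψ.toLp ψ) =
      ∫ z, ψ z * (starRingEnd ℂ) (y z) ∂ν := by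
    intro ψ hψ
    rw [L2.inner_def]
    refine integral_congr_ae ?_
    filter_upwards [hψ.coeFn_toLp] with z hz
    rw [hz, RCLike.inner_apply]
  refine ⟨ν, _, hν, hνS, hq, fun ψ hψ => ?_, ?_⟩
  · have hall : ∀ ε > 0, ‖∫ z, ψ z * (starRingEnd ℂ) (y z) ∂ν‖ ≤ ε * ∫ z, ‖y z‖ ∂ν := by
      intro ε hε
      obtain ⟨P, hPε⟩ := hψ ε hε
      have h0 : ∫ z, MvPolynomial.eval ![z, F z] P * (starRingEnd ℂ) (y z) ∂ν = 0 := by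
        rw [← hinner _ (hP P)]
        exact Submodule.inner_left_of_mem_orthogonal
          (Submodule.le_topologicalClosure _ (LinearMap.mem_range_self T P)) hy
      have hm : ∀ χ : ℂ → ℂ, MemLp χ 2 ν → Integrable (fun z => χ z * (starRingEnd ℂ) (y z)) ν := by
        intro χ hχ
        have := L2.integrable_inner (𝕜 := ℂ) y (hχ.toLp χ)
        refine this.congr ?_
        filter_upwards [hχ.coeFn_toLp] with z hz
        rw [hz, RCLike.inner_apply]
      rw [← sub_zero (∫ z, ψ z * (starRingEnd ℂ) (y z) ∂ν), ← h0,
        ← integral_sub (hm _ (hmem _ (hψ.continuousOn hF))) (hm _ (hP P)), ← integral_const_mul]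
      refine norm_integral_le_of_norm_le (hyi.norm.const_mul ε) ?_
      have : ∀ᵐ z ∂ν, z ∈ S := by rw [ae_iff]; exact hνS
      filter_upwards [this] with z hz
      rw [← sub_mul, norm_mul, RCLike.norm_conj]
      gcongr
      exact (hPε z hz).le
    have hB : 0 ≤ ∫ z, ‖y z‖ ∂ν := integral_nonneg fun _ => norm_nonneg _
    rw [← norm_le_zero_iff]
    refine le_of_forall_pos_le_add fun ε hε => ?_
    refine (hall (ε / (∫ z, ‖y z‖ ∂ν + 1)) (by positivity)).trans ?_
    rw [zero_add, div_mul_eq_mul_div, div_le_iff₀ (by positivity)]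
    nlinarith
  · rw [← hinner φ (hmem φ hφ)]
    exact hyΦ

theorem exists_forall_setLIntegral_enorm_inv_sub_le (r : ℝ) :
    ∃ C : ℝ≥0∞, C ≠ ∞ ∧ ∀ z ∈ closedBall (0 : ℂ) r,
      ∫⁻ ζ in ball (0 : ℂ) r, ‖(z - ζ)⁻¹‖ₑ ≤ C := by
  have hint : IntegrableOn (fun w : ℂ => w⁻¹) (ball 0 (2 * r)) := by
    refine integrableOn_ball_of_norm_le_rpow (μ := volume) (C := 1) (α := 1) (by simp) (by simp)
      (Eventually.of_forall fun x => ?_) measurable_inv.aestronglyMeasurable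
    rw [norm_inv, one_mul, Real.rpow_neg_one]
  refine ⟨∫⁻ w in ball (0 : ℂ) (2 * r), ‖w⁻¹‖ₑ, hint.2.ne, fun z hz => ?_⟩
  rw [← lintegral_indicator measurableSet_ball, ← lintegral_indicator measurableSet_ball,
    ← lintegral_sub_left_eq_self ((ball (0 : ℂ) (2 * r)).indicator _) z]
  refine lintegral_mono fun ζ => ?_
  by_cases hζ : ζ ∈ ball (0 : ℂ) r
  · have : z - ζ ∈ ball (0 : ℂ) (2 * r) := by
      rw [mem_closedBall_zero_iff] at hz
      rw [mem_ball_zero_iff] at hζ ⊢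
      linarith [norm_sub_le z ζ]
    simp only [indicator_of_mem hζ, indicator_of_mem this, le_refl]
  · simp only [indicator_of_notMem hζ, zero_le]

theorem integrableOn_inv_sub {r : ℝ} {z : ℂ} (hz : z ∈ closedBall (0 : ℂ) r) :
    IntegrableOn (fun ζ => (z - ζ)⁻¹) (ball 0 r) := by
  obtain ⟨C, hC, h⟩ := exists_forall_setLIntegral_enorm_inv_sub_le r
  exact ⟨(by fun_prop : Measurable fun ζ => (z - ζ)⁻¹).aestronglyMeasurable,
    (h z hz).trans_lt hC.lt_top⟩

theorem circleAverage_inv_sub_of_lt {z : ℂ} {ρ : ℝ} (h0 : 0 < ρ) (h : ρ < ‖z‖) :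
    Real.circleAverage (fun w => (z - w)⁻¹) 0 ρ = z⁻¹ := by
  have : DiffContOnCl ℂ (fun w => (z - w)⁻¹) (ball 0 |ρ|) := by
    refine DifferentiableOn.diffContOnCl fun w hw => ?_
    rw [abs_of_pos h0, closure_ball _ h0.ne', mem_closedBall_zero_iff] at hw
    have : z - w ≠ 0 := by
      intro h'
      rw [sub_eq_zero] at h'
      subst h'
      linarith
    exact DifferentiableAt.differentiableWithinAt (by fun_prop (disch := assumption))
  simpa using this.circleAverage

theorem circleAverage_inv_sub_of_gt {z : ℂ} {ρ : ℝ} (hz : z ≠ 0) (h : ‖z‖ < ρ) :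
    Real.circleAverage (fun w => (z - w)⁻¹) 0 ρ = 0 := by
  have h0 : 0 < ρ := (norm_nonneg z).trans_lt h
  have hzρ : z ∈ ball (0 : ℂ) |ρ| := by rwa [abs_of_pos h0, mem_ball_zero_iff]
  have hne : ∀ w ∈ sphere (0 : ℂ) |ρ|, w - z ≠ 0 := by
    intro w hw h'
    rw [sub_eq_zero] at h'
    subst h'
    rw [mem_sphere_zero_iff_norm, abs_of_pos h0] at hw
    linarith
  have key := (diffContOnCl_const (c := (1 : ℂ)) (s := ball (0 : ℂ) |ρ|)).circleAverage_smul_div hzρ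
  have hci : CircleIntegrable (fun w => (w - 0) / (w - z) * 1) 0 ρ := by
    refine ContinuousOn.circleIntegrable' ?_
    have := hne
    fun_prop (disch := assumption)
  have e : Real.circleAverage (fun w => (z - w)⁻¹) 0 ρ = Real.circleAverage
      ((-z⁻¹) • ((fun w => (w - 0) / (w - z) * 1) - fun _ => 1)) 0 ρ := by
    refine Real.circleAverage_congr_sphere fun w hw => ?_
    have h1 := hne w hw
    have h2 : z - w ≠ 0 := fun h' => h1 (by linear_combination -h')
    simp only [Pi.smul_apply, Pi.sub_apply, smul_eq_mul]
    field_simp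
    ring
  rw [e, Real.circleAverage_smul, Real.circleAverage_sub hci (circleIntegrable_const _ _ _),
    Real.circleAverage_const]
  simp only [smul_eq_mul] at key
  rw [key]
  simp

theorem setIntegral_ball_inv_sub {r : ℝ} {z : ℂ} (hz : z ∈ closedBall (0 : ℂ) r) :
    ∫ ζ in ball (0 : ℂ) r, (z - ζ)⁻¹ = Real.pi * (starRingEnd ℂ) z := by
  rw [mem_closedBall_zero_iff] at hz
  rcases eq_or_ne z 0 with rfl | hz0
  · have h1 : ∫ ζ in ball (0 : ℂ) r, (0 - ζ)⁻¹ = ∫ ζ in ball (0 : ℂ) r, -(0 - ζ)⁻¹ := by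
      rw [← integral_indicator measurableSet_ball, ← integral_indicator measurableSet_ball,
        ← integral_neg_eq_self]
      congr 1 with ζ
      by_cases h : ζ ∈ ball (0 : ℂ) r
      · have h' : -ζ ∈ ball (0 : ℂ) r := by simpa using h
        simp [indicator_of_mem h, indicator_of_mem h', inv_neg]
      · have h' : -ζ ∉ ball (0 : ℂ) r := by simpa using h
        simp only [indicator_of_notMem h, indicator_of_notMem h']
    rw [integral_neg] at h1
    have h2 : ∫ ζ in ball (0 : ℂ) r, (0 - ζ)⁻¹ = 0 := by linear_combination h1 / 2
    rw [h2, map_zero, mul_zero]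
  set g : ℂ → ℂ := (ball (0 : ℂ) r).indicator fun ζ => (z - ζ)⁻¹ with hg
  have hgm : Measurable g := (by fun_prop : Measurable fun ζ => (z - ζ)⁻¹).indicator
    measurableSet_ball
  have hgi : Integrable g :=
    (integrable_indicator_iff measurableSet_ball).2
      (integrableOn_inv_sub (mem_closedBall_zero_iff.2 hz))
  rw [← integral_indicator measurableSet_ball, ← Complex.integral_comp_polarCoord_symm]
  have hsm : Measurable fun p : ℝ × ℝ => Complex.polarCoord.symm p := by
    simp only [Complex.polarCoord_symm_apply]
    fun_prop
  have hpi : IntegrableOn (fun p : ℝ × ℝ => p.1 • g (Complex.polarCoord.symm p))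
      (Ioi (0 : ℝ) ×ˢ Ioo (-Real.pi) Real.pi) (volume.prod volume) := by
    refine ⟨(measurable_fst.smul (hgm.comp hsm)).aestronglyMeasurable, ?_⟩
    have := hgi.2
    rw [HasFiniteIntegral, ← Complex.lintegral_comp_polarCoord_symm] at this
    refine lt_of_le_of_lt (le_of_eq ?_) this
    refine setLIntegral_congr_fun (measurableSet_Ioi.prod measurableSet_Ioo) fun p hp => ?_
    simp only [enorm_smul, smul_eq_mul]
    rw [Real.enorm_eq_ofReal hp.1.le]
  have := setIntegral_prod _ hpi
  rw [polarCoord_target]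
  refine this.trans ?_
  have inner : ∀ ρ ∈ Ioi (0 : ℝ), ρ ≠ ‖z‖ →
      ∫ θ in Ioo (-Real.pi) Real.pi, ρ • g (Complex.polarCoord.symm (ρ, θ)) =
      (Iio ‖z‖).indicator (fun ρ => (2 * Real.pi * z⁻¹) * (ρ : ℂ)) ρ := by
    intro ρ hρ hρz
    have hρ' : (0 : ℝ) < ρ := hρ
    have e1 : ∀ θ : ℝ, Complex.polarCoord.symm (ρ, θ) = circleMap 0 ρ θ := by
      intro θ
      simp [circleMap, exp_mul_I]
    by_cases hρr : ρ < r
    · have e2 : ∀ θ : ℝ, ρ • g (Complex.polarCoord.symm (ρ, θ)) =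
          ρ • (z - circleMap 0 ρ θ)⁻¹ := by
        intro θ
        rw [e1, hg, indicator_of_mem]
        simpa [abs_of_pos hρ'] using hρr
      simp only [e2]
      have hca : Real.circleAverage (fun w => (z - w)⁻¹) 0 ρ =
          (2 * Real.pi)⁻¹ • ∫ θ in Ioo (-Real.pi) Real.pi, (z - circleMap 0 ρ θ)⁻¹ := by
        rw [Real.circleAverage_eq_integral_add (-Real.pi),
          ← integral_Ioc_eq_integral_Ioo, ← intervalIntegral.integral_of_le
            (by linarith [Real.pi_pos])]
        congr 1
        rw [intervalIntegral.integral_comp_add_right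
          (fun θ => (z - circleMap 0 ρ θ)⁻¹) (-Real.pi)]
        congr 1 <;> ring
      have hval : ∫ θ in Ioo (-Real.pi) Real.pi, (z - circleMap 0 ρ θ)⁻¹ =
          (2 * Real.pi : ℝ) • Real.circleAverage (fun w => (z - w)⁻¹) 0 ρ := by
        rw [hca, smul_smul, mul_inv_cancel₀ (by positivity), one_smul]
      rw [integral_smul, hval]
      rcases lt_or_gt_of_ne hρz with h | h
      · rw [circleAverage_inv_sub_of_lt hρ' h, indicator_of_mem (by exact h)]
        simp
        ring
      · rw [circleAverage_inv_sub_of_gt hz0 h, indicator_of_notMem (by simp [h.le])]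
        simp
    · have e2 : ∀ θ : ℝ, ρ • g (Complex.polarCoord.symm (ρ, θ)) = 0 := by
        intro θ
        rw [e1, hg, indicator_of_notMem, smul_zero]
        simpa [abs_of_pos hρ'] using hρr
      simp only [e2, integral_zero]
      rw [indicator_of_notMem]
      simp only [mem_Iio, not_lt]
      linarith [not_lt.1 hρr]
  have hae : ∀ᵐ ρ : ℝ, ρ ≠ ‖z‖ := by
    simp [ae_iff]
  rw [setIntegral_congr_ae (g := (Iio ‖z‖).indicator (fun ρ => (2 * Real.pi * z⁻¹) * (ρ : ℂ)))
    measurableSet_Ioi (hae.mono fun ρ h1 h2 => inner ρ h2 h1)]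
  rw [setIntegral_indicator measurableSet_Iio, Ioi_inter_Iio, integral_const_mul,
    ← integral_Ioc_eq_integral_Ioo, ← intervalIntegral.integral_of_le (norm_nonneg z),
    intervalIntegral.integral_ofReal, integral_id]
  have hzz : z * (starRingEnd ℂ) z = (‖z‖ : ℂ) ^ 2 := by
    rw [mul_conj, normSq_eq_norm_sq]
    push_cast
    rfl
  push_cast
  rw [zero_pow two_ne_zero, sub_zero, ← hzz]
  field_simp

theorem integral_conj_mul_eq_zero_of_cauchy {ν : Measure ℂ} [IsFiniteMeasure ν] {q : ℂ → ℂ}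
    {r : ℝ} (hν : ν (closedBall 0 r)ᶜ = 0) (hq : Integrable q ν)
    (h : ∀ ζ ∈ ball (0 : ℂ) r, ∫⁻ z, ‖q z‖ₑ * ‖z - ζ‖ₑ⁻¹ ∂ν ≠ ∞ →
      ∫ z, q z * (z - ζ)⁻¹ ∂ν = 0) :
    ∫ z, (starRingEnd ℂ) z * q z ∂ν = 0 := by
  obtain ⟨C, hC, hCb⟩ := exists_forall_setLIntegral_enorm_inv_sub_le r
  have hae : ∀ᵐ z ∂ν, z ∈ closedBall (0 : ℂ) r := by
    rw [ae_iff]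
    exact hν
  have hqm : AEStronglyMeasurable (fun p : ℂ × ℂ => q p.1 * (p.1 - p.2)⁻¹)
      (ν.prod (volume.restrict (ball 0 r))) :=
    hq.1.comp_fst.mul (by fun_prop : Measurable fun p : ℂ × ℂ => (p.1 - p.2)⁻¹).aestronglyMeasurable
  have hqm' : AEMeasurable (fun p : ℂ × ℂ => ‖q p.1‖ₑ * ‖p.1 - p.2‖ₑ⁻¹)
      (ν.prod (volume.restrict (ball 0 r))) :=
    hq.1.comp_fst.enorm.mul
      (by fun_prop : Measurable fun p : ℂ × ℂ => ‖p.1 - p.2‖ₑ⁻¹).aemeasurable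
  have hfin : ∫⁻ ζ in ball (0 : ℂ) r, ∫⁻ z, ‖q z‖ₑ * ‖z - ζ‖ₑ⁻¹ ∂ν < ∞ := by
    rw [lintegral_lintegral_swap (f := fun ζ z => ‖q z‖ₑ * ‖z - ζ‖ₑ⁻¹)]
    · calc ∫⁻ z, (∫⁻ ζ in ball (0 : ℂ) r, ‖q z‖ₑ * ‖z - ζ‖ₑ⁻¹) ∂ν ≤ ∫⁻ z, ‖q z‖ₑ * C ∂ν := by
            refine lintegral_mono_ae ?_
            filter_upwards [hae] with z hz
            rw [lintegral_const_mul _ (by fun_prop)]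
            gcongr
            refine le_trans (lintegral_mono_ae ?_) (hCb z hz)
            have : ∀ᵐ ζ : ℂ, ζ ≠ z := by simp [ae_iff]
            filter_upwards [ae_restrict_of_ae this] with ζ hζ
            rw [enorm_inv (sub_ne_zero.2 hζ.symm)]
        _ < ∞ := by
            rw [lintegral_mul_const'' _ hq.1.enorm]
            exact ENNReal.mul_lt_top hq.2 hC.lt_top
    · exact hqm'.prod_swap
  have hint : Integrable (fun p : ℂ × ℂ => q p.1 * (p.1 - p.2)⁻¹)
      (ν.prod (volume.restrict (ball 0 r))) := by
    refine ⟨hqm, ?_⟩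
    refine lt_of_le_of_lt ?_ hfin
    rw [← lintegral_prod_symm _ hqm']
    refine lintegral_mono fun p => ?_
    rw [enorm_mul]
    gcongr
    rcases eq_or_ne (p.1 - p.2) 0 with h0 | h0
    · simp [h0]
    · rw [enorm_inv h0]
  have hπ : (Real.pi : ℂ) ≠ 0 := by exact_mod_cast Real.pi_ne_zero
  have key : ∫ z, (∫ ζ in ball (0 : ℂ) r, q z * (z - ζ)⁻¹) ∂ν = 0 := by
    rw [integral_integral_swap hint]
    refine integral_eq_zero_of_ae ?_
    have h1 := ae_lt_top' hqm'.lintegral_prod_left' hfin.ne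
    filter_upwards [h1, ae_restrict_mem measurableSet_ball] with ζ hζ hζ'
    exact h ζ hζ' hζ.ne
  have e : ∫ z, (∫ ζ in ball (0 : ℂ) r, q z * (z - ζ)⁻¹) ∂ν =
      ∫ z, Real.pi * ((starRingEnd ℂ) z * q z) ∂ν := by
    refine integral_congr_ae ?_
    filter_upwards [hae] with z hz
    rw [integral_const_mul, setIntegral_ball_inv_sub hz]
    ring
  rw [e, integral_const_mul] at key
  exact (mul_eq_zero.1 key).resolve_left hπ

section

/-- The complex measure `ψ • ν` annihilates all uniform limits on `S` of polynomials in
`z` and `F`. -/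
def Annihilates (F : ℂ → ℂ) (S : Set ℂ) (ν : Measure ℂ) (ψ : ℂ → ℂ) : Prop :=
  Integrable ψ ν ∧ ∀ a, PolyApprox F S a → ∫ z, a z * ψ z ∂ν = 0

variable {F : ℂ → ℂ} {S : Set ℂ} {ν : Measure ℂ} {ψ φ : ℂ → ℂ}

theorem PolyApprox.aestronglyMeasurable (hS : IsCompact S) (hF : ContinuousOn F S)
    (hν : ν Sᶜ = 0) (h : PolyApprox F S φ) : AEStronglyMeasurable φ ν := by
  rw [← Measure.restrict_eq_self_of_ae_mem (s := S) (μ := ν) (by rwa [ae_iff])]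
  exact (h.continuousOn hF).aestronglyMeasurable hS.measurableSet

theorem PolyApprox.mul_integrable (hS : IsCompact S) (hF : ContinuousOn F S)
    (hν : ν Sᶜ = 0) (h : PolyApprox F S φ) (hψ : Integrable ψ ν) :
    Integrable (fun z => φ z * ψ z) ν := by
  obtain ⟨B, -, hB⟩ := h.exists_bound hS hF
  refine hψ.bdd_mul (c := B) (h.aestronglyMeasurable hS hF hν) ?_
  have : ∀ᵐ z ∂ν, z ∈ S := by rwa [ae_iff]
  exact this.mono hB

namespace Annihilates

theorem add (hS : IsCompact S) (hF : ContinuousOn F S)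
    (hν : ν Sᶜ = 0) (h1 : Annihilates F S ν φ) (h2 : Annihilates F S ν ψ) :
    Annihilates F S ν fun z => φ z + ψ z := by
  refine ⟨h1.1.add h2.1, fun a ha => ?_⟩
  simp only [mul_add]
  rw [integral_add (ha.mul_integrable hS hF hν h1.1) (ha.mul_integrable hS hF hν h2.1),
    h1.2 a ha, h2.2 a ha, add_zero]

theorem mul (hS : IsCompact S) (hF : ContinuousOn F S)
    (hν : ν Sᶜ = 0) (hψ : Annihilates F S ν ψ) (hφ : PolyApprox F S φ) :
    Annihilates F S ν fun z => φ z * ψ z := by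
  refine ⟨hφ.mul_integrable hS hF hν hψ.1, fun a ha => ?_⟩
  simp only [← mul_assoc]
  exact hψ.2 _ (ha.mul hS hF hφ)

theorem congr (hψ : Annihilates F S ν ψ) (h : ∀ᵐ z ∂ν, ψ z = φ z) : Annihilates F S ν φ := by
  refine ⟨hψ.1.congr h, fun a ha => ?_⟩
  rw [← hψ.2 a ha]
  exact integral_congr_ae (h.mono fun z hz => by simp only [hz])

theorem of_tendsto (hS : IsCompact S) (hF : ContinuousOn F S) (hν : ν Sᶜ = 0)
    {u : ℕ → ℂ → ℂ} (hu : ∀ n, Annihilates F S ν (u n)) {g : ℂ → ℝ} (hg : Integrable g ν)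
    (hb : ∀ n, ∀ᵐ z ∂ν, ‖u n z‖ ≤ g z)
    (hlim : ∀ᵐ z ∂ν, Tendsto (fun n => u n z) atTop (𝓝 (ψ z))) : Annihilates F S ν ψ := by
  refine ⟨?_, fun a ha => ?_⟩
  · refine Integrable.mono' hg (aestronglyMeasurable_of_tendsto_ae atTop
      (fun n => (hu n).1.1) hlim) ?_
    filter_upwards [ae_all_iff.2 hb, hlim] with z h1 h2
    exact le_of_tendsto h2.norm (Eventually.of_forall h1)
  · obtain ⟨B, -, hB⟩ := ha.exists_bound hS hF
    have hmem : ∀ᵐ z ∂ν, z ∈ S := by rwa [ae_iff]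
    have := tendsto_integral_of_dominated_convergence (μ := ν) (F := fun n z => a z * u n z)
      (f := fun z => a z * ψ z) (fun z => B * g z)
      (fun n => (ha.mul_integrable hS hF hν (hu n).1).1) (hg.const_mul B)
      (fun n => by
        filter_upwards [hb n, hmem] with z h1 h2
        rw [norm_mul]
        exact mul_le_mul (hB z h2) h1 (norm_nonneg _) ((norm_nonneg _).trans (hB z h2)))
      (hlim.mono fun z hz => hz.const_mul _)
    refine tendsto_nhds_unique this ?_
    simp only [(hu _).2 a ha, tendsto_const_nhds]

/-- Multiplication by the a.e. limit on the support of a sequence of approximable functions. -/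
theorem mul_of_tendsto (hS : IsCompact S) (hF : ContinuousOn F S) (hν : ν Sᶜ = 0)
    (hψ : Annihilates F S ν ψ) {u : ℕ → ℂ → ℂ} (hu : ∀ n, PolyApprox F S (u n)) {B : ℝ}
    (hb : ∀ n, ∀ᵐ z ∂ν, ψ z ≠ 0 → ‖u n z‖ ≤ B) {v : ℂ → ℂ}
    (hlim : ∀ᵐ z ∂ν, ψ z ≠ 0 → Tendsto (fun n => u n z) atTop (𝓝 (v z))) :
    Annihilates F S ν fun z => v z * ψ z := by
  refine of_tendsto hS hF hν (fun n => hψ.mul hS hF hν (hu n)) (hψ.1.norm.const_mul B)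
    (fun n => ?_) ?_
  · filter_upwards [hb n] with z hz
    rcases eq_or_ne (ψ z) 0 with h | h
    · simp [h]
    · rw [norm_mul]
      gcongr
      exact hz h
  · filter_upwards [hlim] with z hz
    rcases eq_or_ne (ψ z) 0 with h | h
    · simp [h]
    · exact (hz h).mul_const _

end Annihilates

end

/-- `f` is a bounded a.e. limit of approximable functions `u n` while `(z - ζ) f` is the a.e. limit
of approximable functions with nonnegative real part. -/
def AccretiveLimit (F : ℂ → ℂ) (S : Set ℂ) (ν : Measure ℂ) (ζ : ℂ) (f : ℂ → ℂ) : Prop :=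
  ∃ (u h : ℕ → ℂ → ℂ) (B : ℝ), (∀ n, PolyApprox F S (u n)) ∧ (∀ n, PolyApprox F S (h n)) ∧
    (∀ n, ∀ z ∈ S, 0 ≤ (h n z).re) ∧ (∀ n, ∀ z ∈ S, ‖u n z‖ ≤ B) ∧
    (∀ᵐ z ∂ν, Tendsto (fun n => u n z) atTop (𝓝 (f z))) ∧
    ∀ᵐ z ∂ν, Tendsto (fun n => h n z) atTop (𝓝 ((z - ζ) * f z))

theorem norm_le_norm_add_of_re_nonneg {w : ℂ} (hw : 0 ≤ w.re) {ε : ℝ} (hε : 0 ≤ ε) :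
    ‖w‖ ≤ ‖w + ε‖ := by
  refine le_of_sq_le_sq ?_ (norm_nonneg _)
  rw [← normSq_eq_norm_sq, ← normSq_eq_norm_sq, normSq_apply, normSq_apply]
  simp only [add_re, ofReal_re, add_im, ofReal_im, add_zero]
  nlinarith

theorem le_norm_add_of_re_nonneg {w : ℂ} (hw : 0 ≤ w.re) (ε : ℝ) : ε ≤ ‖w + ε‖ := by
  refine le_trans ?_ (re_le_norm _)
  simpa using hw

namespace AccretiveLimit

variable {F : ℂ → ℂ} {S : Set ℂ} {ν : Measure ℂ} {ψ f : ℂ → ℂ} {ζ : ℂ}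

theorem annihilates_inv_mul_indicator (hS : IsCompact S) (hF : ContinuousOn F S) (hν : ν Sᶜ = 0)
    (hf : AccretiveLimit F S ν ζ f) (hψ : Annihilates F S ν ψ)
    (hψζ : ∀ᵐ z ∂ν, ψ z ≠ 0 → z ≠ ζ) (hint : Integrable (fun z => (z - ζ)⁻¹ * ψ z) ν) :
    Annihilates F S ν fun z => (z - ζ)⁻¹ * {z | f z ≠ 0}.indicator ψ z := by
  obtain ⟨u, h, B, hu, hh, hre, hB, hul, hhl⟩ := hf
  have hmem : ∀ᵐ z ∂ν, z ∈ S := by rwa [ae_iff]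
  have hfre : ∀ᵐ z ∂ν, 0 ≤ ((z - ζ) * f z).re := by
    filter_upwards [hhl, hmem] with z hz hzS
    exact ge_of_tendsto (continuous_re.continuousAt.tendsto.comp hz)
      (Eventually.of_forall fun n => hre n z hzS)
  have hne : ∀ {w : ℂ}, 0 ≤ w.re → ∀ {ε : ℝ}, 0 < ε → w + ε ≠ 0 := fun hw ε hε h0 => by
    have := le_norm_add_of_re_nonneg hw ε
    rw [h0, norm_zero] at this
    linarith
  have step : ∀ ε : ℝ, 0 < ε → Annihilates F S ν
      fun z => f z * ((z - ζ) * f z + ε)⁻¹ * ψ z := by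
    intro ε hε
    refine hψ.mul_of_tendsto hS hF hν
      (u := fun n z => u n z * (h n z + ε)⁻¹) (B := B * ε⁻¹)
      (fun n => (hu n).mul hS hF ((hh n).inv_add hS hF (hre n) hε)) (fun n => ?_) ?_
    · filter_upwards [hmem] with z hz _
      rw [norm_mul, norm_inv]
      have := le_norm_add_of_re_nonneg (hre n z hz) ε
      have h0 : 0 ≤ B := (norm_nonneg _).trans (hB n z hz)
      gcongr
      exact hB n z hz
    · filter_upwards [hul, hhl, hfre] with z h1 h2 h3 _
      exact h1.mul ((h2.add_const _).inv₀ (hne h3 hε))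
  refine Annihilates.of_tendsto hS hF hν (fun k : ℕ => step (1 / (k + 1 : ℝ)) (by positivity))
    hint.norm (fun k => ?_) ?_
  · filter_upwards [hψζ, hfre] with z h1 h2
    rcases eq_or_ne (ψ z) 0 with h | h
    · simp [h]
    · rw [norm_mul, norm_mul (z - ζ)⁻¹]
      gcongr
      have hz : z - ζ ≠ 0 := sub_ne_zero.2 (h1 h)
      have h3 := norm_le_norm_add_of_re_nonneg h2 (ε := 1 / (k + 1 : ℝ)) (by positivity)
      rw [norm_mul] at h3 ⊢
      rw [norm_inv, norm_inv, ← div_eq_mul_inv,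
        div_le_iff₀ (norm_pos_iff.2 (hne h2 (by positivity))),
        ← div_eq_inv_mul, le_div_iff₀ (norm_pos_iff.2 hz)]
      linarith
  · filter_upwards [hψζ, hfre] with z h1 h2
    rcases eq_or_ne (ψ z) 0 with h | h
    · simp [h, indicator]
    · by_cases hfz : f z = 0
      · simp [hfz]
      · have hz : z - ζ ≠ 0 := sub_ne_zero.2 (h1 h)
        rw [indicator_of_mem (by exact hfz)]
        refine Tendsto.mul_const _ ?_
        have h3 : Tendsto (fun k : ℕ => (z - ζ) * f z + ((1 / (k + 1 : ℝ) : ℝ) : ℂ)) atTop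
            (𝓝 ((z - ζ) * f z + (0 : ℝ))) :=
          ((continuous_ofReal.tendsto _).comp
            (tendsto_one_div_add_atTop_nhds_zero_nat (𝕜 := ℝ))).const_add _
        have h4 := (h3.inv₀ (by simpa using ⟨hz, hfz⟩)).const_mul (f z)
        convert h4 using 2
        simp
        field_simp

theorem annihilates_indicator (hS : IsCompact S) (hF : ContinuousOn F S) (hν : ν Sᶜ = 0)
    (hf : AccretiveLimit F S ν ζ f) (hψ : Annihilates F S ν ψ)
    (hψζ : ∀ᵐ z ∂ν, ψ z ≠ 0 → z ≠ ζ) :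
    Annihilates F S ν ({z | f z = 0}.indicator ψ) := by
  obtain ⟨u, h, B, hu, hh, hre, hB, hul, hhl⟩ := hf
  have hmem : ∀ᵐ z ∂ν, z ∈ S := by rwa [ae_iff]
  have hfre : ∀ᵐ z ∂ν, 0 ≤ ((z - ζ) * f z).re := by
    filter_upwards [hhl, hmem] with z hz hzS
    exact ge_of_tendsto (continuous_re.continuousAt.tendsto.comp hz)
      (Eventually.of_forall fun n => hre n z hzS)
  have hne : ∀ {w : ℂ}, 0 ≤ w.re → ∀ {ε : ℝ}, 0 < ε → w + ε ≠ 0 := fun hw ε hε h0 => by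
    have := le_norm_add_of_re_nonneg hw ε
    rw [h0, norm_zero] at this
    linarith
  have hle : ∀ {w : ℂ}, 0 ≤ w.re → ∀ {ε : ℝ}, 0 < ε → ‖ε * (w + ε)⁻¹‖ ≤ 1 := fun hw ε hε => by
    rw [norm_mul, norm_inv, norm_real, Real.norm_of_nonneg hε.le, ← div_eq_mul_inv]
    exact div_le_one_of_le₀ (le_norm_add_of_re_nonneg hw ε) (norm_nonneg _)
  have step : ∀ ε : ℝ, 0 < ε → Annihilates F S ν
      fun z => ε * ((z - ζ) * f z + ε)⁻¹ * ψ z := by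
    intro ε hε
    refine hψ.mul_of_tendsto hS hF hν
      (u := fun n z => ε * (h n z + ε)⁻¹) (B := 1)
      (fun n => ((hh n).inv_add hS hF (hre n) hε).const_mul _) (fun n => ?_) ?_
    · filter_upwards [hmem] with z hz _
      exact hle (hre n z hz) hε
    · filter_upwards [hhl, hfre] with z h2 h3 _
      exact ((h2.add_const _).inv₀ (hne h3 hε)).const_mul _
  refine Annihilates.of_tendsto hS hF hν (fun k : ℕ => step (1 / (k + 1 : ℝ)) (by positivity))
    hψ.1.norm (fun k => ?_) ?_
  · filter_upwards [hfre] with z h2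
    rw [norm_mul]
    exact mul_le_of_le_one_left (norm_nonneg _) (hle h2 (by positivity))
  · filter_upwards [hψζ] with z h1
    rcases eq_or_ne (ψ z) 0 with h | h
    · simp [h, indicator]
    · by_cases hfz : f z = 0
      · rw [indicator_of_mem (by exact hfz)]
        refine tendsto_const_nhds.congr fun k => ?_
        have : ((1 / (k + 1 : ℝ) : ℝ) : ℂ) ≠ 0 := by
          rw [ofReal_ne_zero]
          positivity
        rw [hfz, mul_zero, zero_add, mul_inv_cancel₀ this, one_mul]
      · have hz : z - ζ ≠ 0 := sub_ne_zero.2 (h1 h)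
        rw [indicator_of_notMem (by exact hfz)]
        have h0 : Tendsto (fun k : ℕ => ((1 / (k + 1 : ℝ) : ℝ) : ℂ)) atTop (𝓝 ((0 : ℝ) : ℂ)) :=
          (continuous_ofReal.tendsto _).comp (tendsto_one_div_add_atTop_nhds_zero_nat (𝕜 := ℝ))
        have h3 := (((h0.const_add ((z - ζ) * f z)).inv₀ (by simpa using ⟨hz, hfz⟩)).mul_const
          (ψ z))
        simpa [mul_assoc] using h0.mul h3

end AccretiveLimit

section

variable {F : ℂ → ℂ} {S : Set ℂ} {ν : Measure ℂ} {ψ f : ℂ → ℂ} {ζ η : ℂ}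

theorem HoloNear.dslope {κ : ℂ → ℂ} (hκ : HoloNear κ S) (hη : η ∈ S) :
    HoloNear (dslope κ η) S := by
  obtain ⟨U, hU, hSU, hd⟩ := hκ
  exact ⟨U, hU, hSU, (Complex.differentiableOn_dslope (hU.mem_nhds (hSU hη))).2 hd⟩

theorem AccretiveLimit.of_polyApprox {fη : ℂ → ℂ} (hS : IsCompact S) (hF : ContinuousOn F S)
    (hfη : PolyApprox F S fη) (hre : ∀ z ∈ S, 0 ≤ ((z - η) * fη z).re) :
    AccretiveLimit F S ν η fη := by
  obtain ⟨B, -, hB⟩ := hfη.exists_bound hS hF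
  exact ⟨fun _ => fη, fun _ z => (z - η) * fη z, B, fun _ => hfη,
    fun _ => (PolyApprox.id.sub (.const η)).mul hS hF hfη, fun _ => hre, fun _ => hB,
    Eventually.of_forall fun _ => tendsto_const_nhds,
    Eventually.of_forall fun _ => tendsto_const_nhds⟩

theorem Annihilates.inv_sub_mul_integrable {ρ : ℝ} (hρ : 0 < ρ)
    (hfρ : ∀ᵐ z ∂ν, f z = 0 → ρ ≤ ‖z - η‖) (hψ : Integrable ψ ν)
    (hψf : ∀ᵐ z ∂ν, ψ z ≠ 0 → f z = 0) : Integrable (fun z => (z - η)⁻¹ * ψ z) ν := by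
  refine Integrable.mono' (hψ.norm.const_mul ρ⁻¹)
    ((by fun_prop : Measurable fun z => (z - η)⁻¹).aestronglyMeasurable.mul hψ.1) ?_
  filter_upwards [hfρ, hψf] with z h1 h2
  rcases eq_or_ne (ψ z) 0 with h | h
  · simp [h]
  · rw [norm_mul, norm_inv]
    gcongr
    exact h1 (h2 h)

theorem Annihilates.inv_sub_mul {r : ℝ} (hr : 0 < r) (hF : ContinuousOn F (closedBall 0 r))
    (hν : ν (closedBall 0 r)ᶜ = 0) {fη : ℂ → ℂ} (hη : η ∈ closedBall (0 : ℂ) r)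
    (hfη : PolyApprox F (closedBall 0 r) fη)
    (hre : ∀ z ∈ closedBall (0 : ℂ) r, 0 ≤ ((z - η) * fη z).re) {κ : ℕ → ℂ → ℂ}
    (hκ : ∀ n, HoloNear (κ n) (closedBall 0 r)) {B : ℝ}
    (hB : ∀ n, ∀ z ∈ closedBall (0 : ℂ) r, ‖κ n z‖ ≤ B)
    (hκ0 : ∀ᵐ z ∂ν, f z = 0 → fη z = 0 → Tendsto (fun n => κ n z) atTop (𝓝 0)) {L : ℂ}
    (hL : L ≠ 0) (hκη : Tendsto (fun n => κ n η) atTop (𝓝 L)) {ρ : ℝ} (hρ : 0 < ρ)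
    (hfρ : ∀ᵐ z ∂ν, f z = 0 → ρ ≤ ‖z - η‖) (hψ : Annihilates F (closedBall 0 r) ν ψ)
    (hψf : ∀ᵐ z ∂ν, ψ z ≠ 0 → f z = 0) :
    Annihilates F (closedBall 0 r) ν fun z => (z - η)⁻¹ * ψ z := by
  have hS := isCompact_closedBall (0 : ℂ) r
  have hmem : ∀ᵐ z ∂ν, z ∈ closedBall (0 : ℂ) r := by rwa [ae_iff]
  have hacc : AccretiveLimit F (closedBall 0 r) ν η fη := .of_polyApprox hS hF hfη hre
  have hne : ∀ {z}, ρ ≤ ‖z - η‖ → z ≠ η := fun h h0 => by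
    rw [h0, sub_self, norm_zero] at h
    linarith
  have hψη : ∀ᵐ z ∂ν, ψ z ≠ 0 → z ≠ η := by
    filter_upwards [hψf, hfρ] with z h1 h2 h3
    exact hne (h2 (h1 h3))
  have h1 := hacc.annihilates_inv_mul_indicator hS hF hν hψ hψη
    (inv_sub_mul_integrable hρ hfρ hψ.1 hψf)
  have h2 := hacc.annihilates_indicator hS hF hν hψ hψη
  have h3 : Annihilates F (closedBall 0 r) ν
      fun z => (-L * (z - η)⁻¹) * ({z | fη z = 0}.indicator ψ) z := by
    refine h2.mul_of_tendsto hS hF hν (u := fun n => dslope (κ n) η) (B := ρ⁻¹ * (B + B))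
      (fun n => .of_holoNear hr hF ((hκ n).dslope hη)) (fun n => ?_) ?_
    · filter_upwards [hψf, hfρ, hmem] with z h1 h2 h3 h4
      have h5 := h2 (h1 (right_ne_zero_of_mul (a := 1) (by
        rw [one_mul]
        exact fun h0 => h4 (by simp [indicator, h0]))))
      rw [dslope_of_ne _ (hne h5), slope, vsub_eq_sub, norm_smul, norm_inv]
      have := (norm_sub_le (κ n z) (κ n η)).trans (add_le_add (hB n z h3) (hB n η hη))
      gcongr
    · filter_upwards [hψf, hfρ, hκ0] with z h1 h2 h3 h4
      have h0 : fη z = 0 := by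
        by_contra h0
        exact h4 (indicator_of_notMem (s := {z | fη z = 0}) h0 _)
      rw [indicator_of_mem (by exact h0)] at h4
      have h5 := hne (h2 (h1 h4))
      simp only [dslope_of_ne _ h5, slope, vsub_eq_sub, smul_eq_mul]
      convert ((h3 (h1 h4) h0).sub hκη).const_mul (z - η)⁻¹ using 2
      ring
  refine ((h1.add hS hF hν (h3.mul hS hF hν (.const (-L⁻¹)))).congr
    (Eventually.of_forall fun z => ?_))
  by_cases h0 : fη z = 0
  · rw [indicator_of_notMem (by simpa using h0), indicator_of_mem (by exact h0)]
    field_simp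
    ring
  · rw [indicator_of_mem (by exact h0), indicator_of_notMem (by simpa using h0)]
    ring

/-- Multipliers of annihilating measures carried by the zero set of `f`. -/
def ZeroSetMultiplier (F : ℂ → ℂ) (S : Set ℂ) (ν : Measure ℂ) (f u : ℂ → ℂ) : Prop :=
  (∃ B, ∀ᵐ z ∂ν, f z = 0 → ‖u z‖ ≤ B) ∧ ∀ ψ, Annihilates F S ν ψ →
    (∀ᵐ z ∂ν, ψ z ≠ 0 → f z = 0) → Annihilates F S ν fun z => u z * ψ z

namespace ZeroSetMultiplier

variable {u v : ℂ → ℂ}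

theorem of_polyApprox (hS : IsCompact S) (hF : ContinuousOn F S) (hν : ν Sᶜ = 0)
    (hu : PolyApprox F S u) : ZeroSetMultiplier F S ν f u := by
  obtain ⟨B, -, hB⟩ := hu.exists_bound hS hF
  have hmem : ∀ᵐ z ∂ν, z ∈ S := by rwa [ae_iff]
  exact ⟨⟨B, hmem.mono fun z hz _ => hB z hz⟩, fun ψ hψ _ => hψ.mul hS hF hν hu⟩

theorem add (hS : IsCompact S) (hF : ContinuousOn F S) (hν : ν Sᶜ = 0)
    (hu : ZeroSetMultiplier F S ν f u) (hv : ZeroSetMultiplier F S ν f v) :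
    ZeroSetMultiplier F S ν f fun z => u z + v z := by
  obtain ⟨⟨B1, h1⟩, hu⟩ := hu
  obtain ⟨⟨B2, h2⟩, hv⟩ := hv
  refine ⟨⟨B1 + B2, ?_⟩, fun ψ hψ hψf => ?_⟩
  · filter_upwards [h1, h2] with z h1 h2 hz
    exact (norm_add_le _ _).trans (add_le_add (h1 hz) (h2 hz))
  · simp only [add_mul]
    exact (hu ψ hψ hψf).add hS hF hν (hv ψ hψ hψf)

theorem mul (hu : ZeroSetMultiplier F S ν f u) (hv : ZeroSetMultiplier F S ν f v) :
    ZeroSetMultiplier F S ν f fun z => u z * v z := by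
  obtain ⟨⟨B1, h1⟩, hu⟩ := hu
  obtain ⟨⟨B2, h2⟩, hv⟩ := hv
  refine ⟨⟨B1 * B2, ?_⟩, fun ψ hψ hψf => ?_⟩
  · filter_upwards [h1, h2] with z h1 h2 hz
    rw [norm_mul]
    exact mul_le_mul (h1 hz) (h2 hz) (norm_nonneg _) ((norm_nonneg _).trans (h1 hz))
  · simp only [mul_assoc]
    exact hu _ (hv ψ hψ hψf) (hψf.mono fun z hz h => hz (right_ne_zero_of_mul h))

theorem const (hS : IsCompact S) (hF : ContinuousOn F S) (hν : ν Sᶜ = 0) (c : ℂ) :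
    ZeroSetMultiplier F S ν f fun _ => c :=
  of_polyApprox hS hF hν (.const c)

theorem sub (hS : IsCompact S) (hF : ContinuousOn F S) (hν : ν Sᶜ = 0)
    (hu : ZeroSetMultiplier F S ν f u) (hv : ZeroSetMultiplier F S ν f v) :
    ZeroSetMultiplier F S ν f fun z => u z - v z := by
  simpa [sub_eq_add_neg] using hu.add hS hF hν ((const hS hF hν (-1)).mul hv)

theorem polynomial_eval (hS : IsCompact S) (hF : ContinuousOn F S) (hν : ν Sᶜ = 0)
    (hu : ZeroSetMultiplier F S ν f u) (p : Polynomial ℂ) :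
    ZeroSetMultiplier F S ν f fun z => p.eval (u z) := by
  induction p using Polynomial.induction_on' with
  | add p q hp hq => simpa using hp.add hS hF hν hq
  | monomial n a =>
    simp only [Polynomial.eval_monomial]
    refine (const hS hF hν a).mul ?_
    induction n with
    | zero => simpa using const hS hF hν 1
    | succ n ih => simpa only [pow_succ] using ih.mul hu

theorem of_forall_approx (hS : IsCompact S) (hF : ContinuousOn F S) (hν : ν Sᶜ = 0)
    (h : ∀ ε > 0, ∃ v, ZeroSetMultiplier F S ν f v ∧ ∀ z ∈ S, f z = 0 → ‖u z - v z‖ < ε) :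
    ZeroSetMultiplier F S ν f u := by
  have hmem : ∀ᵐ z ∂ν, z ∈ S := by rwa [ae_iff]
  choose v hv hvu using fun n : ℕ => h (1 / (n + 1 : ℝ)) (by positivity)
  have hub : ∃ B, ∀ᵐ z ∂ν, f z = 0 → ‖u z‖ ≤ B := by
    obtain ⟨B, hB⟩ := (hv 0).1
    refine ⟨1 + B, ?_⟩
    filter_upwards [hB, hmem] with z h1 h2 h3
    have h4 := (hvu 0 z h2 h3).le
    simp only [Nat.cast_zero, zero_add, div_one] at h4
    linarith [norm_sub_norm_le (u z) (v 0 z), h1 h3]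
  refine ⟨hub, fun ψ hψ hψf => ?_⟩
  obtain ⟨B, hB⟩ := hub
  refine Annihilates.of_tendsto hS hF hν (fun n => (hv n).2 ψ hψ hψf)
    (hψ.1.norm.const_mul (B + 1)) (fun n => ?_) ?_
  · filter_upwards [hψf, hB, hmem] with z h1 h2 h3
    rcases eq_or_ne (ψ z) 0 with h0 | h0
    · simp [h0]
    · rw [norm_mul]
      gcongr
      have h4 := (hvu n z h3 (h1 h0)).le
      have h5 : 1 / (n + 1 : ℝ) ≤ 1 := by
        rw [div_le_one (by positivity)]
        simp
      rw [norm_sub_rev] at h4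
      linarith [norm_sub_norm_le (v n z) (u z), h2 (h1 h0)]
  · filter_upwards [hψf, hmem] with z h1 h3
    rcases eq_or_ne (ψ z) 0 with h0 | h0
    · simp [h0]
    · refine Tendsto.mul_const _ ?_
      rw [tendsto_iff_norm_sub_tendsto_zero]
      refine squeeze_zero (fun _ => norm_nonneg _) (fun n => ?_)
        (tendsto_one_div_add_atTop_nhds_zero_nat (𝕜 := ℝ))
      rw [norm_sub_rev]
      exact (hvu n z h3 (h1 h0)).le

end ZeroSetMultiplier

end

theorem norm_sub_one_le_of_re_nonneg {s : ℂ} (hs : 0 ≤ s.re) : ‖s - 1‖ ≤ ‖s ^ 2 - 1‖ := by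
  have h1 : 1 ≤ ‖s + 1‖ := by
    refine le_trans ?_ (re_le_norm _)
    simpa using hs
  have : s ^ 2 - 1 = (s - 1) * (s + 1) := by ring
  rw [this, norm_mul]
  exact le_mul_of_one_le_right (norm_nonneg _) h1

namespace ZeroSetMultiplier

variable {F : ℂ → ℂ} {S : Set ℂ} {ν : Measure ℂ} {f u : ℂ → ℂ}

theorem comp_of_mapsTo_ball (hS : IsCompact S) (hF : ContinuousOn F S) (hν : ν Sᶜ = 0)
    (hu : ZeroSetMultiplier F S ν f u) {g : ℂ → ℂ} {c : ℂ} {R ρ : ℝ} (hρ : ρ < R)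
    (hg : DifferentiableOn ℂ g (ball c R)) (hmaps : ∀ z ∈ S, f z = 0 → u z ∈ closedBall c ρ) :
    ZeroSetMultiplier F S ν f fun z => g (u z) := by
  refine of_forall_approx hS hF hν fun ε hε => ?_
  obtain ⟨p, hp⟩ := exists_polynomial_approx_of_differentiableOn_ball hg hρ hε
  exact ⟨_, hu.polynomial_eval hS hF hν p, fun z hz h => hp _ (hmaps z hz h)⟩

theorem inv_sub_of_approx (hS : IsCompact S) (hF : ContinuousOn F S) (hν : ν Sᶜ = 0) {η : ℂ}
    {ρ : ℝ} (hρ : 0 < ρ) (hfρ : ∀ z ∈ S, f z = 0 → ρ ≤ ‖z - η‖)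
    (h : ∀ ε > 0, ∃ η', ‖η' - η‖ < ε ∧ ZeroSetMultiplier F S ν f fun z => (z - η')⁻¹) :
    ZeroSetMultiplier F S ν f fun z => (z - η)⁻¹ := by
  refine of_forall_approx hS hF hν fun ε hε => ?_
  obtain ⟨η', h1, h2⟩ := h (min (ρ / 2) (ε * (ρ * (ρ / 2)))) (by positivity)
  refine ⟨_, h2, fun z hz h0 => ?_⟩
  have h3 := hfρ z hz h0
  have h4 : ρ / 2 ≤ ‖z - η'‖ := by
    have : z - η' = (z - η) - (η' - η) := by ring
    rw [this]
    linarith [norm_sub_norm_le (z - η) (η' - η), min_le_left (ρ / 2) (ε * (ρ * (ρ / 2)))]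
  have h5 : z - η ≠ 0 := norm_pos_iff.1 (hρ.trans_le h3)
  have h6 : z - η' ≠ 0 := norm_pos_iff.1 ((half_pos hρ).trans_le h4)
  have h7 : (z - η)⁻¹ - (z - η')⁻¹ = -(η' - η) / ((z - η) * (z - η')) := by
    field_simp
    ring
  rw [h7, norm_div, norm_neg, norm_mul, div_lt_iff₀ (by positivity)]
  calc ‖η' - η‖ < ε * (ρ * (ρ / 2)) := h1.trans_le (min_le_right _ _)
    _ ≤ _ := by gcongr

theorem exists_sqrt_of_close (hS : IsCompact S) (hF : ContinuousOn F S) (hν : ν Sᶜ = 0)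
    {x y : ℂ} {ρ : ℝ} (hρ : 0 < ρ) (hfρ : ∀ z ∈ S, f z = 0 → ρ ≤ ‖z - y‖)
    (hy : ZeroSetMultiplier F S ν f fun z => (z - y)⁻¹) (hxy : ‖y - x‖ ≤ ρ / 4) :
    ∃ s, ZeroSetMultiplier F S ν f s ∧
      ∀ z ∈ S, f z = 0 → s z ^ 2 = (z - x) * (z - y)⁻¹ ∧ 0 ≤ (s z).re := by
  have hslit : ∀ w ∈ ball (0 : ℂ) 1, 1 + w ∈ slitPlane := fun w hw =>
    mem_slitPlane_of_norm_lt_one (mem_ball_zero_iff.1 hw)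
  have hg : DifferentiableOn ℂ (fun w => exp (log (1 + w) / 2)) (ball 0 1) := fun w hw =>
    DifferentiableAt.differentiableWithinAt
      ((((differentiableAt_id.const_add 1).clog (hslit w hw)).div_const 2).cexp)
  have hw : ∀ z ∈ S, f z = 0 → (y - x) * (z - y)⁻¹ ∈ closedBall (0 : ℂ) (1 / 4) := by
    intro z hz h0
    have h1 := hfρ z hz h0
    rw [mem_closedBall_zero_iff, norm_mul, norm_inv, ← div_eq_mul_inv,
      div_le_iff₀ (hρ.trans_le h1)]
    linarith
  have hmul := (const hS hF hν (y - x) (f := f)).mul hy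
  refine ⟨_, hmul.comp_of_mapsTo_ball hS hF hν (by norm_num) hg hw, fun z hz h0 => ?_⟩
  have h1 : z - y ≠ 0 := norm_pos_iff.1 (hρ.trans_le (hfρ z hz h0))
  have h2 := slitPlane_ne_zero (hslit _ (closedBall_subset_ball (by norm_num) (hw z hz h0)))
  constructor
  · rw [← exp_nat_mul]
    have : ((2 : ℕ) : ℂ) * (log (1 + (y - x) * (z - y)⁻¹) / 2) =
      log (1 + (y - x) * (z - y)⁻¹) := by
      push_cast
      ring
    rw [this, exp_log h2]
    field_simp
    ring
  · rw [exp_re]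
    refine mul_nonneg (Real.exp_pos _).le (Real.cos_nonneg_of_neg_pi_div_two_le_of_le ?_ ?_) <;>
    · rw [div_ofNat_im, log_im]
      linarith [neg_pi_lt_arg (1 + (y - x) * (z - y)⁻¹), arg_le_pi (1 + (y - x) * (z - y)⁻¹)]

theorem exists_sqrt_of_isPreconnected (hS : IsCompact S) (hF : ContinuousOn F S) (hν : ν Sᶜ = 0)
    {V : Set ℂ} (hV : IsPreconnected V) {ζ : ℂ} {δ : ℝ} (hVδ : V ⊆ ball ζ (4 * δ))
    (hVf : ∀ x ∈ V, ∃ ρ > 0, ∀ z ∈ S, f z = 0 → ρ ≤ ‖z - x‖)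
    (hmul : ∀ x ∈ V, ZeroSetMultiplier F S ν f fun z => (z - x)⁻¹) {a b : ℂ} (ha : a ∈ V)
    (hb : b ∈ V) : ∃ s, ZeroSetMultiplier F S ν f s ∧
      (∀ z ∈ S, f z = 0 → s z ^ 2 = (z - a) * (z - b)⁻¹) ∧
      ∀ z ∈ S, f z = 0 → 36 * δ ≤ ‖z - ζ‖ → ‖s z - 1‖ ≤ 1 / 4 := by
  have hsq : ∀ x ∈ V, ∀ y ∈ V, ∀ z, 36 * δ ≤ ‖z - ζ‖ → ‖(z - x) * (z - y)⁻¹ - 1‖ ≤ 1 / 4 := by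
    intro x hx y hy z hz
    have h1 := mem_ball_iff_norm.1 (hVδ hx)
    have h2 := mem_ball_iff_norm.1 (hVδ hy)
    have hδ : 0 < δ := by linarith [norm_nonneg (x - ζ)]
    have h3 : 32 * δ ≤ ‖z - y‖ := by
      have : z - y = (z - ζ) - (y - ζ) := by ring
      rw [this]
      linarith [norm_sub_norm_le (z - ζ) (y - ζ)]
    have h4 : ‖y - x‖ ≤ 8 * δ := by
      have : y - x = (y - ζ) - (x - ζ) := by ring
      rw [this]
      linarith [norm_sub_le (y - ζ) (x - ζ)]
    have h5 : z - y ≠ 0 := norm_pos_iff.1 (by linarith)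
    have h6 : (z - x) * (z - y)⁻¹ - 1 = (y - x) / (z - y) := by
      field_simp
      ring
    rw [h6, norm_div, div_le_iff₀ (by linarith)]
    linarith
  refine hV.induction₂' (fun x y => ∃ s, ZeroSetMultiplier F S ν f s ∧
      (∀ z ∈ S, f z = 0 → s z ^ 2 = (z - x) * (z - y)⁻¹) ∧
      ∀ z ∈ S, f z = 0 → 36 * δ ≤ ‖z - ζ‖ → ‖s z - 1‖ ≤ 1 / 4) (fun x hx => ?_) ?_ ha hb
  · obtain ⟨ρ, hρ, hfρ⟩ := hVf x hx
    have key : ∀ y ∈ V, ∀ x ∈ V, (∀ z ∈ S, f z = 0 → ρ / 2 ≤ ‖z - y‖) → ‖y - x‖ ≤ ρ / 8 →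
        ∃ s, ZeroSetMultiplier F S ν f s ∧
        (∀ z ∈ S, f z = 0 → s z ^ 2 = (z - x) * (z - y)⁻¹) ∧
        ∀ z ∈ S, f z = 0 → 36 * δ ≤ ‖z - ζ‖ → ‖s z - 1‖ ≤ 1 / 4 := by
      intro y hy x hx hd hyx
      obtain ⟨s, hs, hs'⟩ := exists_sqrt_of_close hS hF hν (half_pos hρ) hd (hmul y hy)
        (hyx.trans (by linarith))
      refine ⟨s, hs, fun z hz h0 => (hs' z hz h0).1, fun z hz h0 hζ => ?_⟩
      refine (norm_sub_one_le_of_re_nonneg (hs' z hz h0).2).trans ?_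
      rw [(hs' z hz h0).1]
      exact hsq x hx y hy z hζ
    filter_upwards [self_mem_nhdsWithin,
      mem_nhdsWithin_of_mem_nhds (ball_mem_nhds x (by positivity : 0 < ρ / 8))] with y hy hyx
    rw [mem_ball_iff_norm] at hyx
    refine ⟨key y hy x hx (fun z hz h0 => ?_) hyx.le, key x hx y hy (fun z hz h0 => ?_) ?_⟩
    · have : z - y = (z - x) - (y - x) := by ring
      rw [this]
      linarith [norm_sub_norm_le (z - x) (y - x), hfρ z hz h0]
    · linarith [hfρ z hz h0]
    · rw [norm_sub_rev]
      exact hyx.le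
  · rintro x y w hx hy hw ⟨s, hs, hs1, hs2⟩ ⟨t, ht, ht1, ht2⟩
    have hst : ∀ z ∈ S, f z = 0 → (s z * t z) ^ 2 = (z - x) * (z - w)⁻¹ := by
      intro z hz h0
      obtain ⟨ρ, hρ, hfρ⟩ := hVf y hy
      have h5 : z - y ≠ 0 := norm_pos_iff.1 (hρ.trans_le (hfρ z hz h0))
      rw [mul_pow, hs1 z hz h0, ht1 z hz h0]
      field_simp
    refine ⟨_, hs.mul ht, hst, fun z hz h0 hζ => ?_⟩
    have h1 := hs2 z hz h0 hζ
    have h2 := ht2 z hz h0 hζ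
    have h3 : ‖s z * t z - 1‖ ≤ 9 / 16 := by
      have e : s z * t z - 1 = (s z - 1) * (t z - 1) + (s z - 1) + (t z - 1) := by ring
      rw [e]
      have : ‖(s z - 1) * (t z - 1)‖ ≤ 1 / 4 * (1 / 4) := by
        rw [norm_mul]
        gcongr
      linarith [norm_add₃_le (a := (s z - 1) * (t z - 1)) (b := s z - 1) (c := t z - 1)]
    have h4 : 0 ≤ (s z * t z).re := by
      have := (abs_le.1 ((abs_re_le_norm _).trans h3)).1
      simp only [sub_re, one_re] at this
      linarith
    refine (norm_sub_one_le_of_re_nonneg h4).trans ?_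
    rw [hst z hz h0]
    exact hsq x hx w hw z hζ

end ZeroSetMultiplier

/-- With `s` a square root of `(z - a) / (z - b)`, this is an approximation of the Cauchy kernel. -/
noncomputable def sqrtKernel (a b : ℂ) (s : ℂ → ℂ) (z : ℂ) : ℂ :=
  8 / (a - b) ^ 2 * ((z - (a + b) / 2) - (z - b) * s z)

section
variable {a b ζ z : ℂ} {s : ℂ → ℂ} {δ : ℝ}

theorem sqrtKernel_eq_of_far (hδ : 0 < δ) (ha : ‖a - ζ‖ ≤ 4 * δ) (hb : ‖b - ζ‖ ≤ 4 * δ)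
    (hab : δ ≤ ‖a - b‖) (hs : s z ^ 2 = (z - a) * (z - b)⁻¹) (hz : 36 * δ ≤ ‖z - ζ‖)
    (hs1 : ‖s z - 1‖ ≤ 1 / 4) : ∃ Y, sqrtKernel a b s z = 2 / Y ∧ ‖Y - 2 * (z - ζ)‖ ≤ 20 * δ := by
  have hX : 32 * δ ≤ ‖z - b‖ := by
    have : z - b = (z - ζ) - (b - ζ) := by ring
    rw [this]
    linarith [norm_sub_norm_le (z - ζ) (b - ζ)]
  have hd : ‖a - b‖ ≤ 8 * δ := by
    have : a - b = (a - ζ) - (b - ζ) := by ring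
    rw [this]
    linarith [norm_sub_le (a - ζ) (b - ζ)]
  have hX0 : z - b ≠ 0 := norm_pos_iff.1 (by linarith)
  have hd0 : a - b ≠ 0 := norm_pos_iff.1 (by linarith)
  have hre : 0 ≤ (s z).re := by
    have := (abs_le.1 ((abs_re_le_norm _).trans hs1)).1
    simp only [sub_re, one_re] at this
    linarith
  have h1 : ‖(z - b) * (s z - 1)‖ ≤ 8 * δ := by
    have h2 := norm_sub_one_le_of_re_nonneg hre
    have h3 : (z - b) * (s z ^ 2 - 1) = -(a - b) := by
      rw [hs]
      field_simp
      ring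
    calc ‖(z - b) * (s z - 1)‖ ≤ ‖(z - b) * (s z ^ 2 - 1)‖ := by
          rw [norm_mul, norm_mul]
          gcongr
      _ ≤ 8 * δ := by rwa [h3, norm_neg]
  have hY : ‖(z - b) * (1 + s z) - (a - b) / 2 - 2 * (z - ζ)‖ ≤ 20 * δ := by
    have e : (z - b) * (1 + s z) - (a - b) / 2 - 2 * (z - ζ) =
        (z - b) * (s z - 1) - 2 * (b - ζ) - (a - b) / 2 := by ring
    rw [e]
    refine (norm_sub_le _ _).trans ((add_le_add_left (norm_sub_le _ _) _).trans ?_)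
    rw [norm_mul 2, norm_div, Complex.norm_ofNat]
    linarith
  refine ⟨_, ?_, hY⟩
  have hY0 : (z - b) * (1 + s z) - (a - b) / 2 ≠ 0 := by
    intro h0
    rw [h0, zero_sub, norm_neg, norm_mul, Complex.norm_ofNat] at hY
    linarith
  have hs' : s z ^ 2 * (z - b) = z - a := by
    rw [hs]
    field_simp
  rw [sqrtKernel, eq_div_iff hY0]
  rw [div_mul_eq_mul_div, div_mul_eq_mul_div, div_eq_iff (pow_ne_zero 2 hd0)]
  linear_combination (-8 * (z - b)) * hs'

theorem norm_sqrtKernel_le (hδ : 0 < δ) (ha : ‖a - ζ‖ ≤ 4 * δ) (hb : ‖b - ζ‖ ≤ 4 * δ)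
    (hab : δ ≤ ‖a - b‖) (hs : s z ^ 2 = (z - a) * (z - b)⁻¹) (hzb : z ≠ b) (hzζ : z ≠ ζ)
    (hs1 : 36 * δ ≤ ‖z - ζ‖ → ‖s z - 1‖ ≤ 1 / 4) :
    ‖sqrtKernel a b s z‖ ≤ 23040 * ‖(z - ζ)⁻¹‖ := by
  have hp : 0 < ‖z - ζ‖ := norm_pos_iff.2 (sub_ne_zero.2 hzζ)
  rw [norm_inv, ← div_eq_mul_inv]
  rcases le_or_gt (36 * δ) ‖z - ζ‖ with hz | hz
  · obtain ⟨Y, hY, hY'⟩ := sqrtKernel_eq_of_far hδ ha hb hab hs hz (hs1 hz)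
    have h1 : ‖z - ζ‖ ≤ ‖Y‖ := by
      have h2 := norm_sub_norm_le (2 * (z - ζ)) Y
      rw [norm_sub_rev, norm_mul, Complex.norm_ofNat] at h2
      linarith
    rw [hY, norm_div, Complex.norm_ofNat]
    gcongr
    norm_num
  · have hX : ‖z - b‖ ≤ 40 * δ := by
      have : z - b = (z - ζ) - (b - ζ) := by ring
      rw [this]
      linarith [norm_sub_le (z - ζ) (b - ζ)]
    have hXa : ‖z - a‖ ≤ 40 * δ := by
      have : z - a = (z - ζ) - (a - ζ) := by ring
      rw [this]
      linarith [norm_sub_le (z - ζ) (a - ζ)]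
    have h1 : ‖z - (a + b) / 2‖ ≤ 40 * δ := by
      have : z - (a + b) / 2 = ((z - a) + (z - b)) / 2 := by ring
      rw [this, norm_div, Complex.norm_ofNat]
      linarith [norm_add_le (z - a) (z - b)]
    have h2 : ‖(z - b) * s z‖ ≤ 40 * δ := by
      refine le_of_sq_le_sq ?_ (by positivity)
      rw [← norm_pow]
      have e : ((z - b) * s z) ^ 2 = (z - b) * (z - a) := by
        rw [mul_pow, hs]
        have := sub_ne_zero.2 hzb
        field_simp
      rw [e, norm_mul, sq]
      gcongr
    have hd : ‖(8 : ℂ) / (a - b) ^ 2‖ ≤ 8 / δ ^ 2 := by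
      rw [norm_div, norm_pow, Complex.norm_ofNat]
      gcongr
    rw [sqrtKernel, norm_mul, le_div_iff₀ hp]
    calc _ ≤ 8 / δ ^ 2 * (40 * δ + 40 * δ) * (36 * δ) := by
          gcongr
          exact (norm_sub_le _ _).trans (add_le_add h1 h2)
      _ = 23040 := by
          field_simp
          norm_num

theorem norm_sqrtKernel_sub_le (hδ : 0 < δ) (ha : ‖a - ζ‖ ≤ 4 * δ) (hb : ‖b - ζ‖ ≤ 4 * δ)
    (hab : δ ≤ ‖a - b‖) (hs : s z ^ 2 = (z - a) * (z - b)⁻¹) (hz : 36 * δ ≤ ‖z - ζ‖)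
    (hs1 : ‖s z - 1‖ ≤ 1 / 4) :
    ‖sqrtKernel a b s z - (z - ζ)⁻¹‖ ≤ 20 * δ / ‖z - ζ‖ ^ 2 := by
  obtain ⟨Y, hY, hY'⟩ := sqrtKernel_eq_of_far hδ ha hb hab hs hz hs1
  have hp : 0 < ‖z - ζ‖ := by linarith
  have hp0 : z - ζ ≠ 0 := norm_pos_iff.1 hp
  have h1 : ‖z - ζ‖ ≤ ‖Y‖ := by
    have h2 := norm_sub_norm_le (2 * (z - ζ)) Y
    rw [norm_sub_rev, norm_mul, Complex.norm_ofNat] at h2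
    linarith
  have hY0 : Y ≠ 0 := norm_pos_iff.1 (hp.trans_le h1)
  have e : 2 / Y - (z - ζ)⁻¹ = -(Y - 2 * (z - ζ)) / (Y * (z - ζ)) := by
    field_simp
    ring
  rw [hY, e, norm_div, norm_neg, norm_mul, sq]
  gcongr

end

theorem Annihilates.inv_sub_mul_of_isPreconnected {F : ℂ → ℂ} {S : Set ℂ} {ν : Measure ℂ}
    {f σ : ℂ → ℂ} {ζ : ℂ} (hS : IsCompact S) (hF : ContinuousOn F S) (hν : ν Sᶜ = 0)
    (hV : ∀ δ₀ > 0, ∃ δ > 0, δ < δ₀ ∧ ∃ V : Set ℂ, IsPreconnected V ∧ V ⊆ ball ζ (4 * δ) ∧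
      (∀ x ∈ V, ∃ ρ > 0, ∀ z ∈ S, f z = 0 → ρ ≤ ‖z - x‖) ∧
      (∀ x ∈ V, ZeroSetMultiplier F S ν f fun z => (z - x)⁻¹) ∧
      ∃ a ∈ V, ∃ b ∈ V, δ ≤ ‖a - b‖)
    (hσ : Annihilates F S ν σ) (hσf : ∀ᵐ z ∂ν, σ z ≠ 0 → f z = 0)
    (hσζ : ∀ᵐ z ∂ν, σ z ≠ 0 → z ≠ ζ) (hint : Integrable (fun z => (z - ζ)⁻¹ * σ z) ν) :
    Annihilates F S ν fun z => (z - ζ)⁻¹ * σ z := by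
  have hmem : ∀ᵐ z ∂ν, z ∈ S := by rwa [ae_iff]
  have key : ∀ n : ℕ, ∃ δ > 0, δ < 1 / (n + 1 : ℝ) ∧ ∃ a b : ℂ, ∃ s, ‖a - ζ‖ ≤ 4 * δ ∧
      ‖b - ζ‖ ≤ 4 * δ ∧ δ ≤ ‖a - b‖ ∧ ZeroSetMultiplier F S ν f s ∧
      (∀ z ∈ S, f z = 0 → z ≠ b) ∧ (∀ z ∈ S, f z = 0 → s z ^ 2 = (z - a) * (z - b)⁻¹) ∧
      ∀ z ∈ S, f z = 0 → 36 * δ ≤ ‖z - ζ‖ → ‖s z - 1‖ ≤ 1 / 4 := by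
    intro n
    obtain ⟨δ, hδ, hδn, V, h1, h2, h3, h4, a, ha, b, hb, hab⟩ :=
      hV (1 / (n + 1 : ℝ)) (by positivity)
    obtain ⟨s, hs, hs1, hs2⟩ :=
      ZeroSetMultiplier.exists_sqrt_of_isPreconnected hS hF hν h1 h2 h3 h4 ha hb
    refine ⟨δ, hδ, hδn, a, b, s, (mem_ball_iff_norm.1 (h2 ha)).le, (mem_ball_iff_norm.1 (h2 hb)).le,
      hab, hs, fun z hz h0 hzb => ?_, hs1, hs2⟩
    obtain ⟨ρ, hρ, hfρ⟩ := h3 b hb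
    have := hfρ z hz h0
    rw [hzb, sub_self, norm_zero] at this
    linarith
  choose δ hδ hδn a b s ha hb hab hs hzb hs1 hs2 using key
  refine Annihilates.of_tendsto hS hF hν (u := fun n z => sqrtKernel (a n) (b n) (s n) z * σ z)
    (fun n => ?_) (hint.norm.const_mul 23040) (fun n => ?_) ?_
  · have hg : ZeroSetMultiplier F S ν f (sqrtKernel (a n) (b n) (s n)) :=
      (ZeroSetMultiplier.const hS hF hν _).mul
        ((ZeroSetMultiplier.of_polyApprox hS hF hν (PolyApprox.id.sub (.const _))).sub hS hF hν
          ((ZeroSetMultiplier.of_polyApprox hS hF hν (PolyApprox.id.sub (.const _))).mul (hs n)))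
    exact hg.2 σ hσ hσf
  · filter_upwards [hσf, hσζ, hmem] with z h1 h2 h3
    rcases eq_or_ne (σ z) 0 with h0 | h0
    · simp [h0]
    · rw [norm_mul, norm_mul, ← mul_assoc]
      gcongr
      exact norm_sqrtKernel_le (hδ n) (ha n) (hb n) (hab n) (hs1 n z h3 (h1 h0))
        (hzb n z h3 (h1 h0)) (h2 h0) (hs2 n z h3 (h1 h0))
  · filter_upwards [hσf, hσζ, hmem] with z h1 h2 h3
    rcases eq_or_ne (σ z) 0 with h0 | h0
    · simp [h0]
    · refine Tendsto.mul_const _ ?_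
      have hp : 0 < ‖z - ζ‖ := norm_pos_iff.2 (sub_ne_zero.2 (h2 h0))
      have hδ0 : Tendsto δ atTop (𝓝 0) :=
        squeeze_zero (fun n => (hδ n).le) (fun n => (hδn n).le)
          (tendsto_one_div_add_atTop_nhds_zero_nat (𝕜 := ℝ))
      have hev : ∀ᶠ n in atTop, 36 * δ n ≤ ‖z - ζ‖ := by
        have := (hδ0.const_mul 36).eventually_lt_const (by simpa using hp : 36 * 0 < ‖z - ζ‖)
        exact this.mono fun n hn => hn.le
      rw [tendsto_iff_norm_sub_tendsto_zero]
      refine squeeze_zero' (Eventually.of_forall fun _ => norm_nonneg _) (hev.mono fun n hn => ?_)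
        (by simpa using (hδ0.const_mul 20).div_const (‖z - ζ‖ ^ 2))
      exact norm_sqrtKernel_sub_le (hδ n) (ha n) (hb n) (hab n) (hs1 n z h3 (h1 h0)) hn
        (hs2 n z h3 (h1 h0) hn)

/-- A component of `{f ≠ 0}` in a small disc reaches far out, provided that the zero set of `f`
carries an accretive function which extends holomorphically. -/
theorem exists_isPreconnected_of_re_nonneg {f κ fa : ℂ → ℂ} {ζ a c : ℂ} {δ : ℝ}
    (hf : ContinuousOn f (ball ζ (4 * δ))) (hκ : DifferentiableOn ℂ κ (ball ζ (4 * δ)))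
    (ha : a ∈ ball ζ δ) (hfa : f a ≠ 0) (hκa : κ a ≠ 0) (hc : c ≠ 0)
    (hκf : ∀ z ∈ ball ζ (4 * δ), f z = 0 → κ z = -c * fa z)
    (hre : ∀ z ∈ ball ζ (4 * δ), 0 ≤ ((z - a) * fa z).re) :
    ∃ V, IsPreconnected V ∧ V ⊆ ball ζ (4 * δ) ∩ {z | f z ≠ 0} ∧
      ∃ a ∈ V, ∃ b ∈ V, δ ≤ ‖a - b‖ := by
  have hδ : 0 < δ := pos_of_mem_ball ha
  set U := ball ζ (4 * δ) ∩ {z | f z ≠ 0} with hUdef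
  have hU : IsOpen U := hf.isOpen_inter_preimage isOpen_ball isOpen_compl_singleton
  have haU : a ∈ U := ⟨ball_subset_ball (by linarith) ha, hfa⟩
  set V := connectedComponentIn U a with hVdef
  have hVU : V ⊆ U := connectedComponentIn_subset U a
  have haV : a ∈ V := mem_connectedComponentIn haU
  have hVo : IsOpen V := hU.connectedComponentIn
  refine ⟨V, isPreconnected_connectedComponentIn, hVU, a, haV, ?_⟩
  by_contra! hfar
  have hV2 : V ⊆ ball ζ (2 * δ) := fun b hb => by
    have h1 := hfar b hb
    rw [mem_ball, dist_eq_norm] at ha ⊢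
    have : b - ζ = (a - ζ) - (a - b) := by ring
    rw [this]
    linarith [norm_sub_le (a - ζ) (a - b)]
  have hcl : closure V ⊆ ball ζ (4 * δ) := fun z hz => by
    have := closure_mono hV2 hz
    exact closedBall_subset_ball (by linarith) (closure_ball_subset_closedBall this)
  have hfr : ∀ z ∈ frontier V, f z = 0 := fun z hz => by
    by_contra h
    have hzU : z ∈ U := ⟨hcl (frontier_subset_closure hz), h⟩
    have hW : connectedComponentIn U z ∈ 𝓝 z :=
      hU.connectedComponentIn.mem_nhds (mem_connectedComponentIn hzU)
    obtain ⟨w, hw1, hw2⟩ := mem_closure_iff_nhds.1 (frontier_subset_closure hz) _ hW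
    have h1 := connectedComponentIn_eq hw1
    have h2 := connectedComponentIn_eq hw2
    have : z ∈ V := by
      rw [hVdef, h2, ← h1]
      exact mem_connectedComponentIn hzU
    exact hz.2 (hVo.interior_eq.symm ▸ this)
  set g : ℂ → ℂ := fun z => exp (c⁻¹ * ((z - a) * κ z)) with hg
  have hgd : DifferentiableOn ℂ g (ball ζ (4 * δ)) := by
    have : DifferentiableOn ℂ (fun z : ℂ => z - a) (ball ζ (4 * δ)) := by fun_prop
    exact ((this.mul hκ).const_mul _).cexp
  have hg1 : ∀ z ∈ closure V, ‖g z‖ ≤ 1 := fun z hz => by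
    refine Complex.norm_le_of_forall_mem_frontier_norm_le
      (isBounded_ball.subset hV2) ⟨hgd.mono (subset_closure.trans hcl),
        hgd.continuousOn.mono hcl⟩ (fun w hw => ?_) hz
    have hwb := hcl (frontier_subset_closure hw)
    simp only [hg, Complex.norm_exp, Real.exp_le_one_iff]
    rw [hκf w hwb (hfr w hw)]
    have : c⁻¹ * ((w - a) * (-c * fa w)) = -((w - a) * fa w) := by field_simp
    rw [this, neg_re]
    linarith [hre w hwb]
  have hga : g a = 1 := by simp [hg]
  have hab : ball ζ (4 * δ) ∈ 𝓝 a := isOpen_ball.mem_nhds haU.1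
  have hmax : IsLocalMax (norm ∘ g) a := by
    filter_upwards [hVo.mem_nhds haV] with z hz
    simpa [hga] using hg1 z (subset_closure hz)
  have hev := Complex.eventually_eq_of_isLocalMax_norm
    (eventually_of_mem hab fun z hz => hgd.differentiableAt (isOpen_ball.mem_nhds hz)) hmax
  have hd0 : HasDerivAt g 0 a := (hasDerivAt_const a (g a)).congr_of_eventuallyEq hev
  have hd1 : HasDerivAt g (c⁻¹ * κ a) a := by
    have h1 := ((((hasDerivAt_id a).sub_const a).mul
      (hκ.differentiableAt hab).hasDerivAt).const_mul c⁻¹).cexp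
    simpa using h1
  exact mul_ne_zero (inv_ne_zero hc) hκa (hd1.unique hd0)

theorem norm_sub_le_of_norm_le_on_ball {g : ℂ → ℂ} {x y : ℂ} {ρ B : ℝ}
    (hg : DifferentiableOn ℂ g (ball x ρ)) (hB : ∀ z ∈ ball x ρ, ‖g z‖ ≤ B) (hy : y ∈ ball x ρ) :
    ‖g y - g x‖ ≤ 2 * B / ρ * ‖y - x‖ := by
  have hρ : 0 < ρ := pos_of_mem_ball hy
  have hmaps : MapsTo g (ball x ρ) (closedBall (g x) (2 * B)) := fun z hz => by
    rw [mem_closedBall, dist_eq_norm]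
    linarith [norm_sub_le (g z) (g x), hB z hz, hB x (mem_ball_self hρ)]
  simpa [dist_eq_norm] using Complex.dist_le_div_mul_dist_of_mapsTo_ball hg hmaps hy

/-- The **Vitali-Porter theorem** for sequences. -/
theorem exists_differentiableOn_tendsto_of_dense {g : ℕ → ℂ → ℂ} {U T : Set ℂ} {B : ℝ}
    (hU : IsOpen U) (hg : ∀ n, DifferentiableOn ℂ (g n) U) (hB : ∀ n, ∀ z ∈ U, ‖g n z‖ ≤ B)
    (hT : U ⊆ closure T) (hgT : ∀ z ∈ T, z ∈ U → CauchySeq fun n => g n z) :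
    ∃ G : ℂ → ℂ, DifferentiableOn ℂ G U ∧ ∀ z ∈ U, Tendsto (fun n => g n z) atTop (𝓝 (G z)) := by
  have hequi : ∀ x ∈ U, ∀ ε > 0, ∀ᶠ y in 𝓝 x, y ∈ U ∧ ∀ n, ‖g n y - g n x‖ < ε := by
    intro x hx ε hε
    obtain ⟨ρ, hρ, hρU⟩ := Metric.isOpen_iff.1 hU x hx
    have hlim : Tendsto (fun y => 2 * B / ρ * ‖y - x‖) (𝓝 x) (𝓝 0) := by
      have : Continuous fun y : ℂ => 2 * B / ρ * ‖y - x‖ := by fun_prop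
      simpa using this.tendsto x
    filter_upwards [hlim.eventually_lt_const hε, ball_mem_nhds x hρ] with y hy hyρ
    exact ⟨hρU hyρ, fun n => (norm_sub_le_of_norm_le_on_ball ((hg n).mono hρU)
      (fun z hz => hB n z (hρU hz)) hyρ).trans_lt hy⟩
  have hcauchy : ∀ x ∈ U, CauchySeq fun n => g n x := by
    intro x hx
    rw [Metric.cauchySeq_iff']
    intro ε hε
    obtain ⟨y, ⟨hyU, hy⟩, hyT⟩ :=
      mem_closure_iff_nhds.1 (hT hx) _ (hequi x hx (ε / 3) (by positivity))
    obtain ⟨N, hN⟩ := Metric.cauchySeq_iff'.1 (hgT y hyT hyU) (ε / 3) (by positivity)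
    refine ⟨N, fun n hn => ?_⟩
    have h1 := hN n hn
    rw [dist_eq_norm] at h1 ⊢
    have : g n x - g N x = (g n y - g N y) - (g n y - g n x) + (g N y - g N x) := by ring
    rw [this]
    linarith [norm_add_le ((g n y - g N y) - (g n y - g n x)) (g N y - g N x),
      norm_sub_le (g n y - g N y) (g n y - g n x), hy n, hy N]
  choose! G hG using fun x hx => cauchySeq_tendsto_of_complete (hcauchy x hx)
  refine ⟨G, ?_, hG⟩
  have hloc : TendstoLocallyUniformlyOn g G atTop U := by
    rw [Metric.tendstoLocallyUniformlyOn_iff]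
    intro ε hε x hx
    refine ⟨_, mem_nhdsWithin_of_mem_nhds (hequi x hx (ε / 4) (by positivity)), ?_⟩
    filter_upwards [(Metric.tendsto_nhds.1 (hG x hx)) (ε / 4) (by positivity)] with n hn
    rintro y ⟨hyU, hy⟩
    have h1 : ‖G y - G x‖ ≤ ε / 4 :=
      le_of_tendsto ((hG y hyU).sub (hG x hx)).norm (Eventually.of_forall fun n => (hy n).le)
    rw [dist_eq_norm] at hn ⊢
    have : G y - g n y = (G y - G x) - (g n x - G x) - (g n y - g n x) := by ring
    rw [this]
    linarith [norm_sub_le ((G y - G x) - (g n x - G x)) (g n y - g n x),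
      norm_sub_le (G y - G x) (g n x - G x), hy n]
  exact hloc.differentiableOn (Eventually.of_forall hg) hU

/-- A convex average of the terms of index at least `n`. -/
structure IsTailWeight (n : ℕ) (w : ℕ →₀ ℝ) : Prop where
  nonneg : ∀ i, 0 ≤ w i
  sum_eq_one : w.sum (fun _ x => x) = 1
  eq_zero : ∀ i < n, w i = 0

namespace IsTailWeight

variable {n : ℕ} {w w' : ℕ →₀ ℝ} {X : Type*} [AddCommGroup X] [Module ℝ X]

theorem mono {m : ℕ} (hw : IsTailWeight n w) (h : m ≤ n) : IsTailWeight m w :=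
  ⟨hw.1, hw.2, fun i hi => hw.3 i (hi.trans_le h)⟩

theorem single (n : ℕ) : IsTailWeight n (Finsupp.single n 1) := by
  refine ⟨fun i => ?_, by simp, fun i hi => by simp [hi.ne']⟩
  rw [Finsupp.single_apply]
  split_ifs <;> norm_num

theorem midpoint (hw : IsTailWeight n w) (hw' : IsTailWeight n w') :
    IsTailWeight n ((1 / 2 : ℝ) • (w + w')) := by
  refine ⟨fun i => ?_, ?_, fun i hi => by simp [hw.3 i hi, hw'.3 i hi]⟩
  · have := hw.1 i
    have := hw'.1 i
    simp only [Finsupp.coe_smul, Finsupp.coe_add, Pi.smul_apply, Pi.add_apply, smul_eq_mul]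
    positivity
  · rw [Finsupp.sum_smul_index (fun _ => rfl), ← Finsupp.mul_sum,
      Finsupp.sum_add_index' (fun _ => rfl) (fun _ _ _ => rfl), hw.2, hw'.2]
    norm_num

theorem linearCombination_mem (hw : IsTailWeight n w) {s : Set X} (hs : Convex ℝ s) {v : ℕ → X}
    (hv : ∀ i, n ≤ i → v i ∈ s) : Finsupp.linearCombination ℝ v w ∈ s := by
  rw [Finsupp.linearCombination_apply]
  refine hs.sum_mem (fun i _ => hw.1 i) hw.2 fun i hi => hv i ?_
  by_contra h
  exact (Finsupp.mem_support_iff.1 hi) (hw.3 i (not_le.1 h))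

end IsTailWeight

theorem exists_isTailWeight_cauchySeq {H : Type*} [NormedAddCommGroup H] [InnerProductSpace ℝ H]
    {x : ℕ → H} {B : ℝ} (hx : ∀ n, ‖x n‖ ≤ B) :
    ∃ w : ℕ → ℕ →₀ ℝ, (∀ n, IsTailWeight n (w n)) ∧
      CauchySeq fun n => Finsupp.linearCombination ℝ x (w n) := by
  let s : ℕ → Set ℝ := fun n =>
    (fun w => ‖Finsupp.linearCombination ℝ x w‖ ^ 2) '' {w | IsTailWeight n w}
  have hsne : ∀ n, (s n).Nonempty := fun n => ⟨_, _, IsTailWeight.single n, rfl⟩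
  have hsbd : ∀ n, BddBelow (s n) := fun n => ⟨0, by rintro _ ⟨w, -, rfl⟩; positivity⟩
  have hanti : ∀ {m n}, m ≤ n → s n ⊆ s m := fun h => image_mono fun w hw => hw.mono h
  have hemono : Monotone fun n => sInf (s n) := fun m n h =>
    csInf_le_csInf (hsbd m) (hsne n) (hanti h)
  have hebd : BddAbove (range fun n => sInf (s n)) := by
    refine ⟨B ^ 2, ?_⟩
    rintro _ ⟨n, rfl⟩
    refine (csInf_le (hsbd n) ⟨_, IsTailWeight.single n, rfl⟩).trans ?_
    simp only [Finsupp.linearCombination_single, one_smul]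
    exact pow_le_pow_left₀ (norm_nonneg _) (hx n) 2
  have hlim := tendsto_atTop_ciSup hemono hebd
  have hex : ∀ n : ℕ, ∃ w, IsTailWeight n w ∧
      ‖Finsupp.linearCombination ℝ x w‖ ^ 2 < sInf (s n) + 1 / (n + 1 : ℝ) := fun n => by
    obtain ⟨_, ⟨w, hw, rfl⟩, h⟩ := Real.lt_sInf_add_pos (hsne n)
      (show (0 : ℝ) < 1 / (n + 1 : ℝ) by positivity)
    exact ⟨w, hw, h⟩
  choose w hw hwlt using hex
  refine ⟨w, hw, ?_⟩
  set y : ℕ → H := fun n => Finsupp.linearCombination ℝ x (w n) with hy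
  have hkey : ∀ {m n}, m ≤ n →
      ‖y n - y m‖ ^ 2 ≤ 2 * (sInf (s n) - sInf (s m)) + 4 * (1 / (m + 1 : ℝ)) := by
    intro m n hmn
    have h1 : sInf (s m) ≤ ‖(1 / 2 : ℝ) • (y n + y m)‖ ^ 2 := by
      refine csInf_le (hsbd m) ⟨_, ((hw n).mono hmn).midpoint (hw m), ?_⟩
      simp [hy]
    rw [norm_smul, mul_pow] at h1
    norm_num at h1
    have h2 := parallelogram_law_with_norm ℝ (y n) (y m)
    have h3 := hwlt n
    have h4 := hwlt m
    have h5 : 1 / (n + 1 : ℝ) ≤ 1 / (m + 1 : ℝ) := by gcongr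
    change ‖y n‖ ^ 2 < _ at h3
    change ‖y m‖ ^ 2 < _ at h4
    nlinarith
  rw [Metric.cauchySeq_iff']
  intro ε hε
  obtain ⟨N1, hN1⟩ := Metric.cauchySeq_iff.1 hlim.cauchySeq (ε ^ 2 / 8) (by positivity)
  obtain ⟨N2, hN2⟩ := exists_nat_one_div_lt (show (0 : ℝ) < ε ^ 2 / 8 by positivity)
  refine ⟨max N1 N2, fun n hn => ?_⟩
  have h1 := hN1 n ((le_max_left _ _).trans hn) (max N1 N2) (le_max_left _ _)
  have h2 := hkey hn
  have h3 : 1 / ((max N1 N2 : ℕ) + 1 : ℝ) ≤ 1 / (N2 + 1 : ℝ) := by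
    gcongr
    exact le_max_right _ _
  rw [Real.dist_eq] at h1
  have h4 := (abs_lt.1 h1).2
  rw [dist_eq_norm]
  refine lt_of_pow_lt_pow_left₀ 2 hε.le (h2.trans_lt ?_)
  linarith [pow_pos hε 2]

theorem coeFn_linearCombination_toLp {μ : Measure ℂ} {g : ℕ → ℂ → ℂ}
    (hg : ∀ n, MemLp (g n) 2 μ) (w : ℕ →₀ ℝ) :
    ⇑(Finsupp.linearCombination ℝ (fun n => (hg n).toLp (g n)) w) =ᵐ[μ]
      fun z => Finsupp.linearCombination ℝ (fun n => g n z) w := by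
  induction w using Finsupp.induction_linear with
  | zero =>
    simp only [map_zero]
    exact Lp.coeFn_zero _ _ _
  | add w w' hw hw' =>
    simp only [map_add]
    exact (Lp.coeFn_add _ _).trans (hw.add hw')
  | single n c =>
    simp only [Finsupp.linearCombination_single]
    exact (Lp.coeFn_smul _ _).trans ((hg n).coeFn_toLp.const_smul c)

theorem exists_isTailWeight_ae_tendsto {μ : Measure ℂ} [IsFiniteMeasure μ] {g : ℕ → ℂ → ℂ} {B : ℝ}
    (hg : ∀ n, AEStronglyMeasurable (g n) μ) (hB : ∀ n, ∀ᵐ z ∂μ, ‖g n z‖ ≤ B) :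
    ∃ w : ℕ → ℕ →₀ ℝ, (∀ n, IsTailWeight n (w n)) ∧ ∃ G : ℂ → ℂ, ∀ᵐ z ∂μ,
      Tendsto (fun n => Finsupp.linearCombination ℝ (fun i => g i z) (w n)) atTop (𝓝 (G z)) := by
  have hmem : ∀ n, MemLp (g n) 2 μ := fun n => MemLp.of_bound (hg n) B (hB n)
  set x : ℕ → Lp ℂ 2 μ := fun n => (hmem n).toLp (g n) with hx
  have hxB : ∃ B', ∀ n, ‖x n‖ ≤ B' := by
    refine ⟨_, fun n => Lp.norm_le_of_ae_bound (C := max B 0) (le_max_right _ _) ?_⟩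
    filter_upwards [(hmem n).coeFn_toLp, hB n] with z h1 h2
    rw [hx, h1]
    exact h2.trans (le_max_left _ _)
  obtain ⟨B', hB'⟩ := hxB
  obtain ⟨w, hw, hcau⟩ := exists_isTailWeight_cauchySeq hB'
  obtain ⟨y, hy⟩ := cauchySeq_tendsto_of_complete hcau
  obtain ⟨k, hk, hlim⟩ := (tendstoInMeasure_of_tendsto_Lp hy).exists_seq_tendsto_ae
  refine ⟨fun n => w (k n), fun n => (hw (k n)).mono (hk.id_le n), y, ?_⟩
  have hall := ae_all_iff.2 fun n => coeFn_linearCombination_toLp hmem (w (k n))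
  filter_upwards [hlim, hall] with z h1 h2
  exact h1.congr h2

theorem HoloNear.linearCombination {S : Set ℂ} {g : ℕ → ℂ → ℂ} (hg : ∀ n, HoloNear (g n) S)
    (w : ℕ →₀ ℝ) : HoloNear (fun z => Finsupp.linearCombination ℝ (fun n => g n z) w) S := by
  induction w using Finsupp.induction_linear with
  | zero => exact ⟨univ, isOpen_univ, subset_univ _, by simp⟩
  | add w w' hw hw' =>
    obtain ⟨U, hU, hSU, hd⟩ := hw
    obtain ⟨V, hV, hSV, hd'⟩ := hw'
    simp only [map_add]
    exact ⟨U ∩ V, hU.inter hV, subset_inter hSU hSV,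
      (hd.mono inter_subset_left).add (hd'.mono inter_subset_right)⟩
  | single n c =>
    obtain ⟨U, hU, hSU, hd⟩ := hg n
    simp only [Finsupp.linearCombination_single]
    exact ⟨U, hU, hSU, hd.const_smul c⟩

theorem PolyApprox.linearCombination {F : ℂ → ℂ} {S : Set ℂ} {g : ℕ → ℂ → ℂ}
    (hg : ∀ n, PolyApprox F S (g n)) (w : ℕ →₀ ℝ) :
    PolyApprox F S fun z => Finsupp.linearCombination ℝ (fun n => g n z) w := by
  simp only [Finsupp.linearCombination_apply, Finsupp.sum, real_smul]
  exact PolyApprox.sum _ (fun n z => (w n : ℂ) * g n z) fun n _ => (hg n).const_mul _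

theorem IsTailWeight.tendsto_linearCombination {w : ℕ → ℕ →₀ ℝ} (hw : ∀ n, IsTailWeight n (w n))
    {x : ℕ → ℂ} {y : ℂ} (hx : Tendsto x atTop (𝓝 y)) :
    Tendsto (fun n => Finsupp.linearCombination ℝ x (w n)) atTop (𝓝 y) := by
  rw [Metric.tendsto_atTop']
  intro ε hε
  obtain ⟨N, hN⟩ := (Metric.tendsto_atTop'.1 hx) ε hε
  exact ⟨N, fun n hn => (hw n).linearCombination_mem (convex_ball y ε)
    fun i hi => hN i (hn.trans_le hi)⟩

theorem exists_accretiveLimit {F Φ : ℂ → ℂ} {r : ℝ} {E : Set ℂ} {ν : Measure ℂ}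
    [IsFiniteMeasure ν] {B : ℝ} {ζ : ℂ} (hr : 0 < r) (hF : ContinuousOn F (closedBall 0 r))
    (hν : ν (closedBall 0 r)ᶜ = 0) (hE : Dense Eᶜ) (hΦ : PolyApprox F (closedBall 0 r) Φ)
    (hsupp : ∀ η ∈ closedBall (0 : ℂ) r \ E, ∃ (c : ℂ) (g : ℂ → ℂ), ‖c‖ = 1 ∧
      HoloNear g (closedBall 0 r) ∧ (∀ z ∈ closedBall (0 : ℂ) r, ‖g z‖ ≤ B) ∧
      c * Φ η + g η = 0 ∧
      ∀ z ∈ closedBall (0 : ℂ) r, 0 ≤ ((z - η) * (c * Φ z + g z)).re)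
    (hζ : ζ ∈ ball (0 : ℂ) r) :
    ∃ (c : ℕ → ℂ) (C : ℂ) (g : ℕ → ℂ → ℂ) (G : ℂ → ℂ), C ≠ 0 ∧ Tendsto c atTop (𝓝 C) ∧
      (∀ n, ‖c n‖ ≤ 1) ∧ (∀ n, HoloNear (g n) (closedBall 0 r)) ∧
      (∀ n, ∀ z ∈ closedBall (0 : ℂ) r, ‖g n z‖ ≤ B) ∧
      (∀ z ∈ ball (0 : ℂ) r, Tendsto (fun n => g n z) atTop (𝓝 (G z))) ∧
      (∀ᵐ z ∂ν, Tendsto (fun n => g n z) atTop (𝓝 (G z))) ∧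
      DifferentiableOn ℂ G (ball 0 r) ∧
      AccretiveLimit F (closedBall 0 r) ν ζ fun z => C * Φ z + G z := by
  have hS := isCompact_closedBall (0 : ℂ) r
  obtain ⟨η, hηE, hη⟩ := mem_closure_iff_seq_limit.1
    (hE.open_subset_closure_inter isOpen_ball hζ)
  choose c g hc hg hgB _ hre using fun n =>
    hsupp (η n) ⟨ball_subset_closedBall (hηE n).1, (hηE n).2⟩
  obtain ⟨C, hC, k, hk, hcC⟩ := (isCompact_sphere (0 : ℂ) 1).tendsto_subseq
    (x := c) fun n => by simpa using hc n
  have hC0 : C ≠ 0 := fun h => by simp [h] at hC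
  have hηk := hη.comp hk.tendsto_atTop
  set μ : Measure ℂ := ν + volume.restrict (ball 0 r) with hμ
  have hμfin : IsFiniteMeasure (volume.restrict (ball (0 : ℂ) r)) :=
    ⟨by simpa using measure_ball_lt_top (μ := volume) (x := (0 : ℂ)) (r := r)⟩
  have hμS : μ (closedBall 0 r)ᶜ = 0 := by
    rw [hμ, Measure.add_apply, hν, Measure.restrict_apply measurableSet_closedBall.compl, zero_add]
    convert measure_empty (μ := volume) using 2
    exact (disjoint_compl_left.mono_right ball_subset_closedBall).inter_eq
  have hmem : ∀ᵐ z ∂μ, z ∈ closedBall (0 : ℂ) r := by rwa [ae_iff]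
  obtain ⟨w, hw, G0, hG0⟩ := exists_isTailWeight_ae_tendsto (μ := μ) (B := B)
    (g := fun n => g (k n))
    (fun n => (PolyApprox.of_holoNear hr hF (hg (k n))).aestronglyMeasurable hS hF hμS)
    (fun n => hmem.mono fun z hz => hgB (k n) z hz)
  rw [hμ, ae_add_measure_iff] at hG0
  set g' : ℕ → ℂ → ℂ := fun n z => Finsupp.linearCombination ℝ (fun i => g (k i) z) (w n) with hg'
  set c' : ℕ → ℂ := fun n => Finsupp.linearCombination ℝ (fun i => c (k i)) (w n) with hc'
  have hg'h : ∀ n, HoloNear (g' n) (closedBall 0 r) := fun n =>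
    HoloNear.linearCombination (fun i => hg (k i)) (w n)
  have hg'B : ∀ n, ∀ z ∈ closedBall (0 : ℂ) r, ‖g' n z‖ ≤ B := fun n z hz => by
    simpa using (hw n).linearCombination_mem (convex_closedBall (0 : ℂ) B)
      (v := fun i => g (k i) z) fun i _ => by simpa using hgB (k i) z hz
  have hc'1 : ∀ n, ‖c' n‖ ≤ 1 := fun n => by
    simpa using (hw n).linearCombination_mem (convex_closedBall (0 : ℂ) 1)
      (v := fun i => c (k i)) fun i _ => by simp [hc]
  have hc'C : Tendsto c' atTop (𝓝 C) := IsTailWeight.tendsto_linearCombination hw hcC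
  obtain ⟨G1, hG1d, hG1⟩ := exists_differentiableOn_tendsto_of_dense (B := B) isOpen_ball
    (fun n => by
      obtain ⟨U, -, hSU, hd⟩ := hg'h n
      exact hd.mono (ball_subset_closedBall.trans hSU))
    (fun n z hz => hg'B n z (ball_subset_closedBall hz))
    (T := {z | z ∈ ball (0 : ℂ) r → CauchySeq fun n => g' n z})
    (Measure.dense_of_ae (μ := volume) (((ae_restrict_iff' measurableSet_ball).1 hG0.2).mono
      fun z hz hzr => (hz hzr).cauchySeq) |>.closure_eq ▸ subset_univ _)
    (fun z hz hzr => hz hzr)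
  classical
  set G : ℂ → ℂ := fun z => if z ∈ ball (0 : ℂ) r then G1 z else G0 z with hG
  have hGball : ∀ z ∈ ball (0 : ℂ) r, Tendsto (fun n => g' n z) atTop (𝓝 (G z)) := fun z hz => by
    simpa only [hG, if_pos hz] using hG1 z hz
  have hGν : ∀ᵐ z ∂ν, Tendsto (fun n => g' n z) atTop (𝓝 (G z)) := by
    filter_upwards [hG0.1] with z hz
    by_cases hzr : z ∈ ball (0 : ℂ) r
    · exact hGball z hzr
    · simpa only [hG, if_neg hzr] using hz
  have hlim : ∀ z, Tendsto (fun n => g' n z) atTop (𝓝 (G z)) →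
      Tendsto (fun n => c' n * Φ z + g' n z) atTop (𝓝 (C * Φ z + G z)) := fun z hz =>
    (hc'C.mul_const _).add hz
  refine ⟨c', C, g', G, hC0, hc'C, hc'1, hg'h, hg'B, hGball, hGν,
    hG1d.congr fun z hz => by simp only [hG, if_pos hz], ?_⟩
  obtain ⟨BΦ, hBΦ0, hBΦ⟩ := hΦ.exists_bound hS hF
  have hbound : ∀ {a b : ℂ} {z : ℂ}, z ∈ closedBall (0 : ℂ) r → ‖a‖ ≤ 1 → ‖b‖ ≤ B →
      ‖a * Φ z + b‖ ≤ BΦ + B := fun {a b z} hz ha hb => by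
    refine (norm_add_le _ _).trans (add_le_add ?_ hb)
    rw [norm_mul]
    nlinarith [hBΦ z hz, norm_nonneg (Φ z), norm_nonneg a]
  have hid : ∀ (e : ℂ), PolyApprox F (closedBall 0 r) fun z => z - e := fun e =>
    PolyApprox.id.sub (.const e)
  refine ⟨fun n z => c' n * Φ z + g' n z, fun n z => Finsupp.linearCombination ℝ
    (fun i => (z - η (k i)) * (c (k i) * Φ z + g (k i) z)) (w n), BΦ + B,
    fun n => (hΦ.const_mul _).add (.of_holoNear hr hF (hg'h n)),
    fun n => PolyApprox.linearCombination (fun i => (hid _).mul hS hF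
      ((hΦ.const_mul _).add (.of_holoNear hr hF (hg (k i))))) (w n),
    fun n z hz => ?_, fun n z hz => hbound hz (hc'1 n) (hg'B n z hz),
    hGν.mono hlim, ?_⟩
  · exact (hw n).linearCombination_mem (convex_halfSpace_re_ge 0)
      (v := fun i => (z - η (k i)) * (c (k i) * Φ z + g (k i) z)) fun i _ => hre (k i) z hz
  · have hmem : ∀ᵐ z ∂ν, z ∈ closedBall (0 : ℂ) r := by rwa [ae_iff]
    filter_upwards [hGν, hmem] with z hz hzS
    have h0 : Tendsto (fun i => (ζ - η (k i)) * (c (k i) * Φ z + g (k i) z)) atTop (𝓝 0) := by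
      refine squeeze_zero_norm (a := fun i => ‖ζ - η (k i)‖ * (BΦ + B)) (fun i => ?_) ?_
      · rw [norm_mul]
        gcongr
        exact hbound hzS (hc _).le (hgB _ z hzS)
      · have := ((tendsto_const_nhds (x := ζ)).sub hηk).norm.mul_const (BΦ + B)
        simpa using this
    have h1 := IsTailWeight.tendsto_linearCombination hw h0
    have h2 := ((hlim z hz).const_mul (z - ζ)).add h1
    rw [add_zero] at h2
    refine h2.congr fun n => ?_
    simp only [hg', hc', Finsupp.linearCombination_apply, Finsupp.sum, real_smul, Finset.sum_mul,
      ← Finset.sum_add_distrib, Finset.mul_sum]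
    exact Finset.sum_congr rfl fun i _ => by ring

theorem Annihilates.integral_cauchy_eq_zero {F Φ : ℂ → ℂ} {r : ℝ} {E : Set ℂ} {ν : Measure ℂ}
    [IsFiniteMeasure ν] {B : ℝ} {ζ : ℂ} {q : ℂ → ℂ} (hr : 0 < r)
    (hF : ContinuousOn F (closedBall 0 r))
    (hν : ν (closedBall 0 r)ᶜ = 0) (hE : Dense Eᶜ) (hΦ : PolyApprox F (closedBall 0 r) Φ)
    (hΦd : ∀ U ⊆ ball (0 : ℂ) r, IsOpen U → DifferentiableOn ℂ Φ U → U = ∅)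
    (hsupp : ∀ η ∈ closedBall (0 : ℂ) r \ E, ∃ (c : ℂ) (g : ℂ → ℂ), ‖c‖ = 1 ∧
      HoloNear g (closedBall 0 r) ∧ (∀ z ∈ closedBall (0 : ℂ) r, ‖g z‖ ≤ B) ∧
      c * Φ η + g η = 0 ∧
      ∀ z ∈ closedBall (0 : ℂ) r, 0 ≤ ((z - η) * (c * Φ z + g z)).re)
    (hq : Annihilates F (closedBall 0 r) ν q) (hζ : ζ ∈ ball (0 : ℂ) r)
    (hfin : ∫⁻ z, ‖q z‖ₑ * ‖z - ζ‖ₑ⁻¹ ∂ν ≠ ∞) :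
    ∫ z, q z * (z - ζ)⁻¹ ∂ν = 0 := by
  have hS := isCompact_closedBall (0 : ℂ) r
  have hmeas : Measurable fun z : ℂ => (z - ζ)⁻¹ := by fun_prop
  have hqζ : ∀ᵐ z ∂ν, q z ≠ 0 → z ≠ ζ := by
    have hm : AEMeasurable (fun z => ‖q z‖ₑ * ‖z - ζ‖ₑ⁻¹) ν :=
      hq.1.1.enorm.mul (by fun_prop)
    filter_upwards [ae_lt_top' hm hfin] with z hz hqz h
    rw [h] at hqz hz
    simp [ENNReal.mul_top (enorm_ne_zero.2 hqz)] at hz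
  have hint : Integrable (fun z => (z - ζ)⁻¹ * q z) ν := by
    refine ⟨hmeas.aestronglyMeasurable.mul hq.1.1, ?_⟩
    refine lt_of_eq_of_lt (lintegral_congr_ae ?_) hfin.lt_top
    filter_upwards [hqζ] with z hz
    rcases eq_or_ne (q z) 0 with h | h
    · simp [h]
    · rw [enorm_mul, mul_comm, enorm_inv (sub_ne_zero.2 (hz h))]
  obtain ⟨c, C, g, G, hC0, hcC, hc1, hg, hgB, hgG, hgGν, hGd, hacc⟩ :=
    exists_accretiveLimit hr hF hν hE hΦ hsupp hζ
  set f : ℂ → ℂ := fun z => C * Φ z + G z with hf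
  have hfc : ContinuousOn f (ball 0 r) :=
    ((hΦ.continuousOn hF).mono ball_subset_closedBall |>.const_smul C).add hGd.continuousOn
  have hsep : ∀ η ∈ ball (0 : ℂ) r, f η ≠ 0 → ∃ ρ > 0, ∀ z, f z = 0 → ρ ≤ ‖z - η‖ := by
    intro η hη hfη
    obtain ⟨ρ, hρ, h⟩ := Metric.eventually_nhds_iff.1
      ((hfc.continuousAt (isOpen_ball.mem_nhds hη)).eventually_ne hfη)
    refine ⟨ρ, hρ, fun z hz => ?_⟩
    by_contra! hlt
    exact h (by rwa [dist_eq_norm]) hz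
  have hdense : ∀ U ⊆ ball (0 : ℂ) r, IsOpen U → U.Nonempty → ∃ a ∈ U, a ∉ E ∧ f a ≠ 0 := by
    intro U hU hUo hUne
    have hne : (U ∩ {z | f z ≠ 0}).Nonempty := by
      by_contra! h
      refine hUne.ne_empty (hΦd U hU hUo ?_)
      refine ((hGd.mono hU).neg.const_smul C⁻¹).congr fun z hz => ?_
      have h0 : f z = 0 := by
        by_contra h0
        exact notMem_empty z (h ▸ ⟨hz, h0⟩)
      have h1 : G z = -(C * Φ z) := eq_neg_of_add_eq_zero_right h0
      simp [h1, hC0]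
    have ho : IsOpen (U ∩ {z | f z ≠ 0}) :=
      (hfc.mono hU).isOpen_inter_preimage hUo isOpen_compl_singleton
    obtain ⟨a, ha, haE⟩ := hE.inter_open_nonempty _ ho hne
    exact ⟨a, ha.1, haE, ha.2⟩
  have hmult0 : ∀ η ∈ ball (0 : ℂ) r, η ∉ E → f η ≠ 0 →
      ZeroSetMultiplier F (closedBall 0 r) ν f fun z => (z - η)⁻¹ := by
    intro η hη hηE hfη
    obtain ⟨ρ, hρ, hfρ⟩ := hsep η hη hfη
    have hηS := ball_subset_closedBall hη
    obtain ⟨d, e, hd, he, heB, hη0, hre⟩ := hsupp η ⟨hηS, hηE⟩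
    have hd0 : d ≠ 0 := fun h => by simp [h] at hd
    refine ⟨⟨ρ⁻¹, Eventually.of_forall fun z hz => ?_⟩, fun ψ hψ hψf => ?_⟩
    · rw [norm_inv]
      exact inv_anti₀ hρ (hfρ z hz)
    refine Annihilates.inv_sub_mul (fη := fun z => d * Φ z + e z)
      (κ := fun n z => g n z - c n * d⁻¹ * e z) (B := B + B) hr hF hν hηS
      ((hΦ.const_mul d).add (.of_holoNear hr hF he)) hre (fun n => ?_) (fun n z hz => ?_)
      ?_ hfη ?_ hρ (Eventually.of_forall hfρ) hψ hψf
    · obtain ⟨U, hU, hSU, hgd⟩ := hg n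
      obtain ⟨V, hV, hSV, hed⟩ := he
      exact ⟨U ∩ V, hU.inter hV, subset_inter hSU hSV, (hgd.mono inter_subset_left).sub
        ((hed.mono inter_subset_right).const_mul _)⟩
    · refine (norm_sub_le _ _).trans (add_le_add (hgB n z hz) ?_)
      rw [norm_mul, norm_mul, norm_inv, hd, inv_one, mul_one]
      nlinarith [heB z hz, norm_nonneg (e z), hc1 n]
    · filter_upwards [hgGν] with z hz hfz hfηz
      have h1 : G z = -(C * Φ z) := eq_neg_of_add_eq_zero_right hfz
      have h2 : e z = -(d * Φ z) := eq_neg_of_add_eq_zero_right hfηz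
      have h3 := hz.sub ((hcC.mul_const d⁻¹).mul_const (e z))
      convert h3 using 2
      rw [h1, h2]
      field_simp
      ring
    · have h2 : e η = -(d * Φ η) := eq_neg_of_add_eq_zero_right hη0
      have h3 := (hgG η hη).sub ((hcC.mul_const d⁻¹).mul_const (e η))
      convert h3 using 2
      rw [h2, hf]
      field_simp
      ring
  have hmult : ∀ η ∈ ball (0 : ℂ) r, f η ≠ 0 →
      ZeroSetMultiplier F (closedBall 0 r) ν f fun z => (z - η)⁻¹ := by
    intro η hη hfη
    obtain ⟨ρ, hρ, hfρ⟩ := hsep η hη hfη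
    refine ZeroSetMultiplier.inv_sub_of_approx hS hF hν hρ (fun z _ => hfρ z) fun ε hε => ?_
    obtain ⟨a, ⟨ha, haε⟩, haE, hfa⟩ := hdense (ball 0 r ∩ ball η ε) inter_subset_left
      (isOpen_ball.inter isOpen_ball) ⟨η, hη, mem_ball_self hε⟩
    exact ⟨a, by rwa [← dist_eq_norm], hmult0 a ha haE hfa⟩
  have hσ := hacc.annihilates_indicator hS hF hν hq hqζ
  have hind : ∀ z, {z | f z = 0}.indicator q z ≠ 0 → f z = 0 ∧ q z ≠ 0 := fun z hz =>
    ⟨mem_of_indicator_ne_zero (s := {z | f z = 0}) hz, fun h => hz (by simp [indicator, h])⟩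
  have hσint : Integrable (fun z => (z - ζ)⁻¹ * {z | f z = 0}.indicator q z) ν := by
    refine hint.norm.mono' (hmeas.aestronglyMeasurable.mul hσ.1.1)
      (Eventually.of_forall fun z => ?_)
    rw [norm_mul, norm_mul]
    gcongr
    exact norm_indicator_le_norm_self _ _
  have hV : ∀ δ₀ > 0, ∃ δ > 0, δ < δ₀ ∧ ∃ V : Set ℂ, IsPreconnected V ∧ V ⊆ ball ζ (4 * δ) ∧
      (∀ x ∈ V, ∃ ρ > 0, ∀ z ∈ closedBall (0 : ℂ) r, f z = 0 → ρ ≤ ‖z - x‖) ∧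
      (∀ x ∈ V, ZeroSetMultiplier F (closedBall 0 r) ν f fun z => (z - x)⁻¹) ∧
      ∃ a ∈ V, ∃ b ∈ V, δ ≤ ‖a - b‖ := by
    intro δ₀ hδ₀
    have hζr : 0 < r - dist ζ 0 := sub_pos.2 hζ
    obtain ⟨δ, hδ, hδlt⟩ := exists_between (lt_min hδ₀ (show 0 < (r - dist ζ 0) / 4 by linarith))
    have hδr : ball ζ (4 * δ) ⊆ ball 0 r :=
      ball_subset_ball' (by linarith [hδlt.trans_le (min_le_right _ _)])
    obtain ⟨a, ha, haE, hfa⟩ := hdense (ball ζ δ)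
      ((ball_subset_ball (by linarith)).trans hδr) isOpen_ball ⟨ζ, mem_ball_self hδ⟩
    have har := hδr (ball_subset_ball (by linarith) ha)
    obtain ⟨d, e, hd, ⟨U, -, hSU, hed⟩, heB, ha0, hre⟩ := hsupp a ⟨ball_subset_closedBall har, haE⟩
    have hd0 : d ≠ 0 := fun h => by simp [h] at hd
    have hmul : ∀ x : ℂ, C * d⁻¹ * (d * x) = C * x := fun x => by field_simp
    have hκa : G a - C * d⁻¹ * e a = f a := by
      rw [eq_neg_of_add_eq_zero_right ha0, mul_neg, hmul, hf]
      ring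
    obtain ⟨V, hVc, hVsub, hab⟩ := exists_isPreconnected_of_re_nonneg
      (κ := fun z => G z - C * d⁻¹ * e z) (fa := fun z => d * Φ z + e z) (c := C * d⁻¹)
      (hfc.mono hδr) ((hGd.mono hδr).sub
        ((hed.mono ((hδr.trans ball_subset_closedBall).trans hSU)).const_mul _))
      ha hfa (by rwa [hκa]) (mul_ne_zero hC0 (inv_ne_zero hd0))
      (fun z hz hfz => by
        rw [eq_neg_of_add_eq_zero_right hfz, neg_mul, mul_add, hmul]
        ring)
      (fun z hz => hre z (ball_subset_closedBall (hδr hz)))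
    refine ⟨δ, hδ, hδlt.trans_le (min_le_left _ _), V, hVc, fun z hz => (hVsub hz).1,
      fun x hx => ?_, fun x hx => hmult x (hδr (hVsub hx).1) (hVsub hx).2, hab⟩
    obtain ⟨ρ, hρ, h⟩ := hsep x (hδr (hVsub hx).1) (hVsub hx).2
    exact ⟨ρ, hρ, fun z _ => h z⟩
  have h1 := Annihilates.inv_sub_mul_of_isPreconnected hS hF hν hV hσ
    (Eventually.of_forall fun z hz => (hind z hz).1)
    (hqζ.mono fun z hz h => hz (hind z h).2) hσint
  have h2 := (hacc.annihilates_inv_mul_indicator hS hF hν hq hqζ hint).add hS hF hν h1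
  have h3 := h2.2 _ (.const 1)
  rw [← h3]
  refine integral_congr_ae (Eventually.of_forall fun z => ?_)
  by_cases h : f z = 0 <;> simp [indicator, h, mul_comm]

theorem PolyApprox.congr {F φ ψ : ℂ → ℂ} {S : Set ℂ} (h : PolyApprox F S φ)
    (hφψ : ∀ z ∈ S, φ z = ψ z) : PolyApprox F S ψ := fun ε hε =>
  (h ε hε).imp fun _ hP z hz => hφψ z hz ▸ hP z hz

theorem PolyApprox.of_continuousOn {F g : ℂ → ℂ} {S : Set ℂ} (hS : IsCompact S)
    (hF : ContinuousOn F S) (hconj : PolyApprox F S (starRingEnd ℂ)) (hg : ContinuousOn g S) :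
    PolyApprox F S g := by
  have : CompactSpace S := isCompact_iff_compactSpace.1 hS
  set e : C(S, ℂ) → ℂ → ℂ := fun f => Function.extend Subtype.val f 0 with he
  have hext : ∀ (f : C(S, ℂ)) (z) (hz : z ∈ S), e f z = f ⟨z, hz⟩ := fun f z hz =>
    Subtype.val_injective.extend_apply f 0 ⟨z, hz⟩
  suffices h : ∀ f : C(S, ℂ), PolyApprox F S (e f) from
    (h ⟨S.domRestrict g, hg.domRestrict⟩).congr fun z hz => hext _ z hz
  intro f
  induction f using ContinuousMap.induction_on_of_compact with
  | const c => exact (PolyApprox.const c).congr fun z hz => by simp [hext _ z hz]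
  | id => exact PolyApprox.id.congr fun z hz => by simp [hext _ z hz]
  | star_id => exact hconj.congr fun z hz => by simp [hext _ z hz]
  | add f g hf hg => exact (hf.add hg).congr fun z hz => by simp [hext _ z hz]
  | mul f g hf hg => exact (hf.mul hS hF hg).congr fun z hz => by simp [hext _ z hz]
  | frequently f h =>
    refine .of_forall_approx fun ε hε => ?_
    obtain ⟨g, hg, hfg⟩ := (h.and_eventually (Metric.ball_mem_nhds f hε)).exists
    refine ⟨e g, hg, fun z hz => ?_⟩
    rw [hext _ z hz, hext _ z hz, ← dist_eq_norm, dist_comm]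
    exact (ContinuousMap.dist_apply_le_dist _).trans_lt hfg

theorem eq_empty_of_differentiableOn_of_isNowhereDense_dbar {F : ℂ → ℂ} {F' : ℂ → ℂ →L[ℝ] ℂ}
    {S U : Set ℂ} (hF' : ∀ z ∈ S, HasFDerivWithinAt F (F' z) S z)
    (hnd : IsNowhereDense {z ∈ S | dbar F' z = 0}) (hUS : U ⊆ S) (hU : IsOpen U)
    (hFU : DifferentiableOn ℂ F U) : U = ∅ := by
  refine subset_empty_iff.1 (hnd ▸ interior_maximal (subset_closure.trans' fun z hz => ?_) hU)
  have h1 := (hF' z (hUS hz)).hasFDerivAt (mem_of_superset (hU.mem_nhds hz) hUS)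
  have h2 := (hFU.differentiableAt (hU.mem_nhds hz)).hasFDerivAt
  have h3 := h1.unique (h2.restrictScalars ℝ)
  refine ⟨hUS hz, ?_⟩
  have h4 : (fderiv ℂ F z) I = I * (fderiv ℂ F z) 1 := by
    rw [← smul_eq_mul, ← map_smul, smul_eq_mul, mul_one]
  rw [dbar, h3]
  simp only [ContinuousLinearMap.coe_restrictScalars', h4, ← mul_assoc, I_mul_I]
  ring

end

/-- Theorem 1.1 (second part): if additionally `F ∈ C¹(D̄)` and the zero set of
`∂F/∂z̄` is nowhere dense and finitely connected, then `[z, F]_{D̄} = C(D̄)`. -/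
theorem holder_uniform_approx (r α M K ν : ℝ) (hr : 0 < r)
    (hα0 : 0 < α) (hα1 : α < 1)
    (F A : ℂ → ℂ) (E : Set ℂ)
    (hF : HolderOn F α (closedBall 0 r))
    (hE : E ⊆ closedBall 0 r) (hEnd : IsNowhereDense E)
    (hA : HoloNear A (closedBall 0 r))
    (hA0 : ∀ z ∈ closedBall (0 : ℂ) r, A z ≠ 0)
    (hM : 0 < M) (hK : 0 < K) (hν : 1 ≤ ν)
    (hyp : ∀ ζ ∈ closedBall (0 : ℂ) r \ E,
      ∃ G : ℂ → ℂ, HoloNear G (closedBall 0 r) ∧ G ζ = 0 ∧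
        (∀ z ∈ closedBall (0 : ℂ) r, ‖G z‖ ≤ M * ‖z - ζ‖) ∧
        ∃ C : ℂ, ‖C‖ = 1 ∧
          ∀ z ∈ closedBall (0 : ℂ) r,
            C * (z - ζ) * (A z * F z - A ζ * F ζ + G z) ∈ wedge K ν)
    -- `F ∈ C¹(D̄)`, with (continuous) real Fréchet derivative `F'`:
    (F' : ℂ → ℂ →L[ℝ] ℂ)
    (hF' : ∀ z ∈ closedBall (0 : ℂ) r, HasFDerivWithinAt F (F' z) (closedBall 0 r) z)
    (hF'c : ContinuousOn F' (closedBall 0 r))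
    (hLnd : IsNowhereDense {z ∈ closedBall (0 : ℂ) r | dbar F' z = 0})
    (hLfc : FinitelyConnected {z ∈ closedBall (0 : ℂ) r | dbar F' z = 0}) :
    ∀ g : ℂ → ℂ, ContinuousOn g (closedBall 0 r) → ∀ ε > 0,
      ∃ P : MvPolynomial (Fin 2) ℂ, ∀ z ∈ closedBall (0 : ℂ) r,
        ‖g z - MvPolynomial.eval ![z, F z] P‖ < ε := by
  intro g hg
  have hS := isCompact_closedBall (0 : ℂ) r
  have hFc : ContinuousOn F (closedBall 0 r) := fun z hz => (hF' z hz).continuousWithinAt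
  have hΦ : PolyApprox F (closedBall 0 r) fun z => A z * F z :=
    (PolyApprox.of_holoNear hr hFc hA).mul hS hFc .self
  refine PolyApprox.of_continuousOn hS hFc ?_ hg
  by_contra hconj
  obtain ⟨m, q, hm, hmS, hq, hann, hne⟩ :=
    exists_annihilating_density hS hFc continuous_conj.continuousOn hconj
  refine hne (integral_conj_mul_eq_zero_of_cauchy hmS hq fun ζ hζ hfin => ?_)
  obtain ⟨B, -, hB⟩ := hΦ.exists_bound hS hFc
  have hEdense : Dense Eᶜ := interior_eq_empty_iff_dense_compl.1
    (Set.subset_empty_iff.1 (hEnd ▸ interior_mono subset_closure))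
  refine Annihilates.integral_cauchy_eq_zero (B := M * (r + r) + B) hr hFc hmS hEdense hΦ
    (fun U hUr hU hd => ?_) (fun η hη => ?_) ⟨hq, hann⟩ hζ hfin
  · have hUS := hUr.trans ball_subset_closedBall
    refine eq_empty_of_differentiableOn_of_isNowhereDense_dbar hF' hLnd hUS hU ?_
    obtain ⟨V, -, hSV, hAV⟩ := hA
    refine (hd.div (hAV.mono (hUS.trans hSV)) fun z hz => hA0 z (hUS hz)).congr fun z hz => ?_
    exact (mul_div_cancel_left₀ _ (hA0 z (hUS hz))).symm
  · obtain ⟨G, ⟨U, hU, hSU, hG⟩, hG0, hGM, C, hC, hW⟩ := hyp η hη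
    refine ⟨C, fun z => C * (G z - A η * F η), hC,
      ⟨U, hU, hSU, (hG.sub_const _).const_mul C⟩, fun z hz => ?_, ?_, fun z hz => ?_⟩
    · rw [norm_mul, hC, one_mul]
      refine (norm_sub_le _ _).trans (add_le_add ((hGM z hz).trans ?_) (hB η hη.1))
      gcongr
      refine (norm_sub_le _ _).trans (add_le_add ?_ ?_)
      · simpa using hz
      · simpa using hη.1
    · simp only [hG0]
      ring
    · convert (hW z hz).1 using 2
      ring
end
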